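/- arXiv:2009.02389 — 2 statements merged into one kernel-verified Lean document; each statement's English description precedes it below -/
import Mathlib

section
/- Let s be a weak composition. The edge labeling λ of the s-Tamari lattice that assigns to each cover relation T ⋖ Z the label a, where (a,b) is the unique Tamari tree ascent of T such that Z is the s-Tamari rotation of T along (a,b), is an SB-labeling of the s-Tamari lattice. Consequently (with the order complex Δ(T,Z) of each open interval and the Möbius function μ of the s-Tamari lattice), every open interval (T,Z) in the s-Tamari lattice has order complex homotopy equivalent to a ball or a sphere of some dimension, and μ(T,Z) ∈ {−1, 0, 1}. -/
open scoped Classical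

/-- An `s`-decreasing tree with internal vertices `1,…,n` (the root is `n`), encoded by
recording, for each non-root internal vertex `v`, its parent `parent v` (an internal vertex
with a larger label, so that labels decrease away from the root) and the index `idx v` of
the child slot of `parent v` (among `0,…,s (parent v)`, left to right) containing `v`.
Distinct internal vertices occupy distinct child slots; all remaining slots are leaves. -/
structure SDecTree (n : ℕ) (s : ℕ → ℕ) where
  parent : ℕ → ℕ
  idx : ℕ → ℕ
  parent_gt : ∀ v, 1 ≤ v → v < n → v < parent v
  parent_le : ∀ v, 1 ≤ v → v < n → parent v ≤ n
  idx_le : ∀ v, 1 ≤ v → v < n → idx v ≤ s (parent v)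
  slot_inj : ∀ v w, 1 ≤ v → v < n → 1 ≤ w → w < n →
      parent v = parent w → idx v = idx w → v = w
  parent_out : ∀ v, v = 0 ∨ n ≤ v → parent v = 0
  idx_out : ∀ v, v = 0 ∨ n ≤ v → idx v = 0

namespace SDecTree

variable {n : ℕ} {s : ℕ → ℕ}

/-- `y` is a weak ancestor of `x`, i.e. `x` is a labeled vertex of the subtree `T^y`. -/
def Descend (T : SDecTree n s) (x y : ℕ) : Prop :=
  ∃ k, T.parent^[k] x = y ∧ ∀ m ≤ k, 1 ≤ T.parent^[m] x ∧ T.parent^[m] x ≤ n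

/-- `x` is a labeled vertex of the subtree `T^y_j` rooted at the `j`-th child of `y`. -/
def InSub (T : SDecTree n s) (y j x : ℕ) : Prop :=
  ∃ c, T.Descend x c ∧ T.parent c = y ∧ T.idx c = j

/-- `x` lies strictly left of `y` in the planar tree `T`. -/
def LeftOf (T : SDecTree n s) (x y : ℕ) : Prop :=
  ∃ z j₁ j₂, j₁ < j₂ ∧ T.InSub z j₁ x ∧ T.InSub z j₂ y

/-- The cardinality `#_T(y,x)` of the pair `(y,x)`: it is `j` if `x ∈ T^y_j`
(so `0` if `x ∈ T^y_0` and `s y` if `x ∈ T^y_{s y}`), `0` if `x` is left of `y`, and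
`s y` if `x` is right of `y`; it is `0` for out-of-range pairs. -/
noncomputable def card (T : SDecTree n s) (y x : ℕ) : ℕ :=
  if h : ∃ j, T.InSub y j x then h.choose
  else if 1 ≤ x ∧ x < y ∧ y ≤ n ∧ ¬ T.LeftOf x y then s y else 0

/-- `x` is a labeled vertex of `T^a ∖ 0`, i.e. of `T^a` with `T^a_0` replaced by a leaf. -/
def InSubMinus0 (T : SDecTree n s) (a x : ℕ) : Prop :=
  x = a ∨ ∃ j, 0 < j ∧ T.InSub a j x

/-- `(a,b)` is a tree ascent of `T`. -/
def TreeAscent (T : SDecTree n s) (a b : ℕ) : Prop :=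
  1 ≤ a ∧ a < b ∧ b ≤ n ∧
  (∃ i, i < s b ∧ T.InSub b i a) ∧
  (∀ e j, a < e → e < b → T.InSub e j a → j = s e) ∧
  (0 < s a → ∀ x, ¬ T.InSub a (s a) x)

end SDecTree

/-- A multi-inversion set (encoded by its multiplicity function) is transitive:
if `a < b < c` then `#(b,a) = 0` or `#(c,a) ≥ #(c,b)`. -/
def IsTransitiveInv (I : ℕ → ℕ → ℕ) : Prop :=
  ∀ a b c, a < b → b < c → I b a = 0 ∨ I c b ≤ I c a

/-- The transitive closure of a multi-inversion set: the smallest (by inclusion, i.e.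
pointwise on multiplicities) transitive multi-inversion set containing it. -/
noncomputable def tcInv (I : ℕ → ℕ → ℕ) : ℕ → ℕ → ℕ := fun y x =>
  sInf {m | ∃ J : ℕ → ℕ → ℕ, IsTransitiveInv J ∧ (∀ y' x', I y' x' ≤ J y' x') ∧ J y x = m}

/-- Add one copy of the inversion `(b,a)` to `I`, capping the multiplicity at `s b`. -/
def addInv (s : ℕ → ℕ) (I : ℕ → ℕ → ℕ) (b a : ℕ) : ℕ → ℕ → ℕ := fun y x =>
  if y = b ∧ x = a then min (I y x + 1) (s y) else I y x

namespace SDecTree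

variable {n : ℕ} {s : ℕ → ℕ}

/-- The `s`-weak order: `T ⪯ Z` iff `#_T(y,x) ≤ #_Z(y,x)` for all pairs. -/
def wle (T Z : SDecTree n s) : Prop := ∀ y x, T.card y x ≤ Z.card y x

/-- Strict `s`-weak order. -/
def wlt (T Z : SDecTree n s) : Prop := wle T Z ∧ ¬ wle Z T

/-- Cover relation in the `s`-weak order. -/
def wcov (T Z : SDecTree n s) : Prop := wlt T Z ∧ ∀ U, wlt T U → wlt U Z → False

/-- `W` is the join of `T` and `Z` in the `s`-weak order. -/
def IsJoin (T Z W : SDecTree n s) : Prop :=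
  wle T W ∧ wle Z W ∧ ∀ U, wle T U → wle Z U → wle W U

/-- `Z` is the `s`-tree rotation of `T` along the tree ascent `(a,b)`, i.e.
`inv Z = (inv T + (b,a))^tc`. -/
def IsRotation (T Z : SDecTree n s) (a b : ℕ) : Prop :=
  T.TreeAscent a b ∧
  ∀ y x, 1 ≤ x → x < y → y ≤ n → Z.card y x = tcInv (addInv s T.card b a) y x

/-- The set `A_T(a,b)` of inversions added by a rotation producing `Z`: the pairs `(f,e)`
with `#_Z(f,e) > #_T(f,e)`. -/
def Aset (T Z : SDecTree n s) : Set (ℕ × ℕ) :=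
  {p | T.card p.1 p.2 < Z.card p.1 p.2}

/-- The set `A_T(a,b)` described directly via the transitive closure. -/
def ARot (T : SDecTree n s) (a b : ℕ) : Set (ℕ × ℕ) :=
  {p | T.card p.1 p.2 < tcInv (addInv s T.card b a) p.1 p.2}

/-- The set `F_T(a,c)` (here `b` and `d` are the partners of `a` and `c` in the
respective tree ascents `(a,b)` and `(c,d)`): it is `{(d,e) : e ∈ T^a∖0}` if `b = c`
and `a ∈ T^c_0`, and empty otherwise. -/
def Fset (T : SDecTree n s) (a b c d : ℕ) : Set (ℕ × ℕ) :=
  {p | b = c ∧ T.InSub c 0 a ∧ p.1 = d ∧ T.InSubMinus0 a p.2}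

/-- `T` is an `s`-Tamari tree: `#_T(c,a) ≤ #_T(c,b)` whenever `a < b < c`. -/
def IsTamari (T : SDecTree n s) : Prop :=
  ∀ a b c, a < b → b < c → T.card c a ≤ T.card c b

/-- `(a,b)` is a Tamari tree ascent of `T`: `a` is a non-rightmost child of `b`. -/
def TamariAscent (T : SDecTree n s) (a b : ℕ) : Prop :=
  1 ≤ a ∧ a < n ∧ T.parent a = b ∧ T.card b a < s b

/-- `Z` is the `s`-Tamari rotation of `T` along the Tamari tree ascent `(a,b)`. -/
def IsTamRotation (T Z : SDecTree n s) (a b : ℕ) : Prop :=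
  T.TamariAscent a b ∧
  ∀ y x, 1 ≤ x → x < y → y ≤ n → Z.card y x = tcInv (addInv s T.card b a) y x

/-- Cover relation in the `s`-Tamari lattice. -/
def tamcov (T Z : SDecTree n s) : Prop :=
  IsTamari T ∧ IsTamari Z ∧ wlt T Z ∧ ∀ U, IsTamari U → wlt T U → wlt U Z → False

/-- `W` is the join of `T` and `Z` in the `s`-Tamari lattice. -/
def IsTamJoin (T Z W : SDecTree n s) : Prop :=
  IsTamari W ∧ wle T W ∧ wle Z W ∧ ∀ U, IsTamari U → wle T U → wle Z U → wle W U

/-- The open interval `(T,Z)` in the `s`-weak order. -/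
def OpenInterval (T Z : SDecTree n s) : Set (SDecTree n s) := {U | wlt T U ∧ wlt U Z}

/-- A set of trees forming a chain in the `s`-weak order. -/
def IsChainSet (C : Set (SDecTree n s)) : Prop :=
  C.Pairwise fun U V => wlt U V ∨ wlt V U

/-- The geometric realization of the order complex `Δ(T,Z)` of the open interval `(T,Z)`
in the `s`-weak order: the space of finitely supported probability vectors on the vertex
set whose support is a chain of the open interval. -/
def orderComplex (T Z : SDecTree n s) : Set (SDecTree n s → ℝ) :=
  {f | (∀ U, 0 ≤ f U) ∧ (Function.support f).Finite ∧
    Function.support f ⊆ OpenInterval T Z ∧ IsChainSet (Function.support f) ∧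
    ∑ᶠ U, f U = 1}

/-- The geometric realization of the order complex of the open interval `(T,Z)` in the
`s`-Tamari lattice. -/
def tamOrderComplex (T Z : SDecTree n s) : Set (SDecTree n s → ℝ) :=
  {f | (∀ U, 0 ≤ f U) ∧ (Function.support f).Finite ∧
    Function.support f ⊆ {U | IsTamari U ∧ wlt T U ∧ wlt U Z} ∧
    IsChainSet (Function.support f) ∧ ∑ᶠ U, f U = 1}

end SDecTree

/-- The list of labels of the consecutive cover relations along a saturated chain,
recorded as a list of poset elements. -/
def labelsOf {α : Type*} (lab : α → α → ℕ) (L : List α) : List ℕ :=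
  (L.zip L.tail).map fun p => lab p.1 p.2

/-! ### Multiplicity functions of `s`-Tamari trees -/

/-- Monotone transitive bounded multiplicity functions: these are exactly the
multi-inversion sets of the `s`-Tamari trees. -/
structure GoodInv (n : ℕ) (s : ℕ → ℕ) (I : ℕ → ℕ → ℕ) : Prop where
  out : ∀ y x, ¬ (1 ≤ x ∧ x < y ∧ y ≤ n) → I y x = 0
  le : ∀ y x, I y x ≤ s y
  mono : ∀ a b c, a < b → b < c → I c a ≤ I c b
  tr : ∀ a b c, a < b → b < c → 0 < I b a → I c b ≤ I c a

/-- `y` is an ancestor of `x`, expressed through the multiplicities. -/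
def AncInv (I : ℕ → ℕ → ℕ) (x y : ℕ) : Prop := ∀ c, y < c → I c x = I c y

/-- `b` is the parent of `a`, expressed through the multiplicities. -/
structure ParInv (n : ℕ) (I : ℕ → ℕ → ℕ) (a b : ℕ) : Prop where
  lt : a < b
  le : b ≤ n
  anc : AncInv I a b
  min : ∀ y, a < y → y < b → ¬ AncInv I a y

/-- The rotation of `I` at `(a,b)`. -/
noncomputable def rotInv (I : ℕ → ℕ → ℕ) (a b : ℕ) : ℕ → ℕ → ℕ := fun y x =>
  if y = b ∧ (x = a ∨ 0 < I a x) then I b a + 1 else I y x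

/-- The largest multiplicity function not exceeding `i` at `(d,c)` (given suitable data). -/
noncomputable def capInv (n : ℕ) (s : ℕ → ℕ) (c d i : ℕ) : ℕ → ℕ → ℕ := fun y x =>
  if 1 ≤ x ∧ x < y ∧ y ≤ n then
    (if x ≤ c ∧ c < y ∧ y < d then 0 else if x ≤ c ∧ y = d then i else s y)
  else 0

section combinatorics

variable {n : ℕ} {s : ℕ → ℕ} {I K : ℕ → ℕ → ℕ} {a b c d x y : ℕ}

theorem GoodInv.one_le (h : GoodInv n s I) (hp : 0 < I y x) : 1 ≤ x ∧ x < y ∧ y ≤ n := by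
  by_contra hc
  have := h.out y x hc
  omega

theorem GoodInv.pos_anc (h : GoodInv n s I) (hp : 0 < I y x) : AncInv I x y := by
  intro c hc
  have h1 := (h.one_le hp).2.1
  exact le_antisymm (h.mono _ _ _ h1 hc) (h.tr _ _ _ h1 hc hp)

theorem AncInv.trans (h1 : AncInv I x y) (h2 : AncInv I y c) (hyc : y ≤ c) : AncInv I x c := by
  intro z hz
  rw [h1 z (by omega), h2 z hz]

theorem AncInv.between (h : GoodInv n s I) (h1 : AncInv I x y) (hx : x < c) (hy : c < y) :
    AncInv I c y := by
  intro z hz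
  have := h1 z hz
  have h2 := h.mono x c z hx (by omega)
  have h3 := h.mono c y z hy hz
  omega

theorem ParInv.le_of_anc (h : ParInv n I a b) (h1 : AncInv I a y) (hy : a < y) : b ≤ y := by
  by_contra hc
  exact h.min y hy (by omega) h1

theorem ParInv.unique (h : ParInv n I a b) (h' : ParInv n I a c) : b = c :=
  le_antisymm (h.le_of_anc h'.anc h'.lt) (h'.le_of_anc h.anc h.lt)

theorem ParInv.le_of_pos (h : ParInv n I a b) (hg : GoodInv n s I) (h1 : 0 < I y a) : b ≤ y :=
  h.le_of_anc (hg.pos_anc h1) (hg.one_le h1).2.1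

theorem ParInv.zero (h : ParInv n I a b) (hg : GoodInv n s I) (hy : y < b) : I y a = 0 := by
  by_contra hc
  have := h.le_of_pos hg (y := y) (by omega)
  omega

theorem exists_parInv (I : ℕ → ℕ → ℕ) (hg : GoodInv n s I) (ha : a < n) :
    ∃ b, ParInv n I a b := by
  have hex : ∃ b, a < b ∧ b ≤ n ∧ AncInv I a b :=
    ⟨n, ha, le_rfl, fun c hc => by
      rw [hg.out c a (by omega), hg.out c n (by omega)]⟩
  have h := Nat.find_spec hex
  refine ⟨Nat.find hex, h.1, h.2.1, h.2.2, fun y h1 h2 h3 => ?_⟩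
  exact Nat.find_min hex h2 ⟨h1, by omega, h3⟩

theorem ParInv.step (h : ParInv n I a b) (hg : GoodInv n s I) :
    ∀ k x, b - x ≤ k → a < x → x < b → I b a < I b x := by
  intro k
  induction k with
  | zero => intro x h1 h2 h3; omega
  | succ k ih =>
    intro x h1 h2 h3
    by_contra hc
    have hm := hg.mono a x b h2 h3
    have hna := h.min x h2 h3
    unfold AncInv at hna
    push Not at hna
    obtain ⟨z, hz, hne⟩ := hna
    have hm2 := hg.mono a x z h2 hz
    rcases lt_trichotomy z b with hzb | hzb | hzb
    · have hp : 0 < I z x := by omega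
      have h4 := ih z (by omega) (by omega) hzb
      have h5 := hg.pos_anc hp b hzb
      omega
    · subst hzb; omega
    · have h4 := h.anc z hzb
      have h5 := hg.mono x b z h3 hzb
      omega

theorem ParInv.slt (h : ParInv n I a b) (hg : GoodInv n s I) (h2 : a < x) (h3 : x < b) :
    I b a < I b x := h.step hg (b - x) x le_rfl h2 h3

theorem rot_self : rotInv I a b b a = I b a + 1 := by simp [rotInv]

theorem rot_ne (h : y ≠ b) : rotInv I a b y x = I y x := by simp [rotInv, h]

theorem rot_raised (hx : x = a ∨ 0 < I a x) : rotInv I a b b x = I b a + 1 := by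
  simp [rotInv, hx]

theorem rot_not (hx : ¬ (x = a ∨ 0 < I a x)) : rotInv I a b y x = I y x := by
  simp [rotInv, hx]

theorem same_slot (hg : GoodInv n s I) (hab : a < b) (hx : x = a ∨ 0 < I a x) :
    I b x = I b a := by
  rcases hx with rfl | hx
  · rfl
  · exact hg.pos_anc hx b hab

theorem le_rot (hg : GoodInv n s I) (hab : a < b) : I y x ≤ rotInv I a b y x := by
  by_cases hy : y = b
  · subst hy
    by_cases hx : x = a ∨ 0 < I a x
    · rw [rot_raised hx, same_slot hg hab hx]; omega
    · rw [rot_not hx]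
  · rw [rot_ne hy]

theorem rot_le (hg : GoodInv n s I) (hK : GoodInv n s K) (hle : ∀ y x, I y x ≤ K y x)
    (hab : a < b) (h : I b a + 1 ≤ K b a) : rotInv I a b y x ≤ K y x := by
  by_cases hy : y = b
  · subst hy
    by_cases hx : x = a ∨ 0 < I a x
    · rw [rot_raised hx]
      rcases hx with rfl | hx
      · exact h
      · have h1 := hK.tr x a y (hg.one_le hx).2.1 hab (lt_of_lt_of_le hx (hle _ _))
        omega
    · rw [rot_not hx]; exact hle _ _
  · rw [rot_ne hy]; exact hle _ _

theorem rot_good (hg : GoodInv n s I) (ha : 1 ≤ a) (hp : ParInv n I a b) (hs : I b a < s b) :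
    GoodInv n s (rotInv I a b) := by
  have hab := hp.lt
  have hbn := hp.le
  constructor
  · intro y x h
    by_cases hy : y = b
    · subst hy
      have hx : ¬ (x = a ∨ 0 < I a x) := by
        rintro (rfl | hx)
        · omega
        · have := hg.one_le hx; omega
      rw [rot_not hx]; exact hg.out _ _ h
    · rw [rot_ne hy]; exact hg.out _ _ h
  · intro y x
    by_cases hy : y = b
    · subst hy
      by_cases hx : x = a ∨ 0 < I a x
      · rw [rot_raised hx]; omega
      · rw [rot_not hx]; exact hg.le _ _
    · rw [rot_ne hy]; exact hg.le _ _
  · intro x y z hxy hyz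
    by_cases hz : z = b
    · subst hz
      by_cases hx : x = a ∨ 0 < I a x
      · rw [rot_raised hx]
        by_cases hy : y = a ∨ 0 < I a y
        · rw [rot_raised hy]
        · rw [rot_not hy]
          have hay : a < y := by
            rcases hx with rfl | hx
            · exact hxy
            · by_contra hc
              have : y < a := by omega
              have := hg.mono x y a hxy this
              omega
          exact hp.slt hg hay hyz
      · rw [rot_not hx]
        exact le_trans (hg.mono _ _ _ hxy hyz) (le_rot hg hab)
    · rw [rot_ne hz, rot_ne hz]; exact hg.mono _ _ _ hxy hyz
  · intro x y z hxy hyz hpos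
    by_cases hz : z = b
    · subst hz
      rw [rot_ne (by omega)] at hpos
      by_cases hy : y = a ∨ 0 < I a y
      · have hx : x = a ∨ 0 < I a x := by
          rcases hy with rfl | hy
          · exact Or.inr hpos
          · exact Or.inr (lt_of_lt_of_le hy (hg.tr x y a hxy (hg.one_le hy).2.1 hpos))
        rw [rot_raised hx, rot_raised hy]
      · rw [rot_not hy]
        exact le_trans (hg.tr _ _ _ hxy hyz hpos) (le_rot hg hab)
    · rw [rot_ne hz, rot_ne hz]
      by_cases hy : y = b
      · subst hy
        by_cases hx : x = a ∨ 0 < I a x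
        · rw [same_slot hg (by omega) hx, hp.anc z hyz]
        · rw [rot_not hx] at hpos
          exact hg.tr _ _ _ hxy hyz hpos
      · rw [rot_ne hy] at hpos
        exact hg.tr _ _ _ hxy hyz hpos

theorem cap_good {i : ℕ} (hi : i ≤ s d) : GoodInv n s (capInv n s c d i) := by
  constructor
  · intro y x h; simp [capInv, h]
  · intro y x
    unfold capInv
    split_ifs with h1 h2 h3
    · omega
    · rw [h3.2]; exact hi
    · exact le_rfl
    · omega
  · intro x y z hxy hyz
    by_cases hz : z = d
    · subst hz; unfold capInv; split_ifs <;> omega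
    · unfold capInv; split_ifs <;> omega
  · intro x y z hxy hyz
    by_cases hz : z = d
    · subst hz; unfold capInv; split_ifs <;> omega
    · unfold capInv; split_ifs <;> omega

theorem le_cap (hg : GoodInv n s I) (hp : ParInv n I c d) :
    I y x ≤ capInv n s c d (I d c) y x := by
  unfold capInv
  split_ifs with h1 h2 h3
  · have h4 := hp.zero hg h2.2.2
    rcases Nat.lt_or_ge x c with h5 | h5
    · have := hg.mono x c y h5 h2.2.1; omega
    · have : x = c := by omega
      subst this; omega
  · obtain ⟨h3, rfl⟩ := h3
    rcases Nat.lt_or_ge x c with h5 | h5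
    · exact hg.mono x c y h5 hp.lt
    · have : x = c := by omega
      subst this; omega
  · exact hg.le _ _
  · rw [hg.out _ _ h1]

theorem cap_self (hc : 1 ≤ c) (hcd : c < d) (hd : d ≤ n) {i : ℕ} : capInv n s c d i d c = i := by
  simp [capInv, hc, hcd, hd]

/-- The cap at `c` lies above all rotations at other ascents. -/
theorem cap_rot (hg : GoodInv n s I) (ha : 1 ≤ a) (hp : ParInv n I a b) (hs : I b a < s b)
    (hpc : ParInv n I c d) (hac : a ≠ c) : I b a + 1 ≤ capInv n s c d (I d c) b a := by
  have h0 := hp.lt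
  have h00 := hp.le
  unfold capInv
  rw [if_pos ⟨ha, hp.lt, hp.le⟩]
  split_ifs with h2 h3
  · exfalso
    have h4 : AncInv I c b := hp.anc.between hg (by omega) h2.2.1
    have := hpc.le_of_anc h4 h2.2.1
    omega
  · obtain ⟨h3, rfl⟩ := h3
    exact hp.slt hg (by omega) hpc.lt
  · exact hs

/-- Rotating at a smaller ascent keeps the parent of a larger ascent. -/
theorem rot_par (hp : ParInv n I a b) (hg : GoodInv n s I) (hac : a < c) (hpc : ParInv n I c d) :
    ParInv n (rotInv I a b) c d := by
  have key : ∀ z y, a < y → rotInv I a b z y = I z y := by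
    intro z y hy
    apply rot_not
    rintro (rfl | h)
    · omega
    · have := hg.one_le h; omega
  have h2 : ∀ y, c < y → (AncInv (rotInv I a b) c y ↔ AncInv I c y) := by
    intro y hy
    unfold AncInv
    simp only [key _ c hac, key _ y (hac.trans hy)]
  exact ⟨hpc.lt, hpc.le, (h2 d hpc.lt).2 hpc.anc, fun y h3 h4 h5 => hpc.min y h3 h4 ((h2 y h3).1 h5)⟩

/-- Pointwise infimum of good functions. -/
theorem inf_good (P : (ℕ → ℕ → ℕ) → Prop) (hP : ∀ J, P J → GoodInv n s J) (hne : ∃ J, P J) :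
    ∃ J, GoodInv n s J ∧ (∀ K, P K → ∀ y x, J y x ≤ K y x) ∧
      ∀ K : ℕ → ℕ → ℕ, (∀ K', P K' → ∀ y x, K y x ≤ K' y x) → ∀ y x, K y x ≤ J y x := by
  let S : ℕ → ℕ → Set ℕ := fun y x => {m | ∃ J, P J ∧ J y x = m}
  have hS : ∀ y x, (S y x).Nonempty := fun y x => by
    obtain ⟨J, hJ⟩ := hne
    exact ⟨J y x, J, hJ, rfl⟩
  have h1 : ∀ K, P K → ∀ y x, sInf (S y x) ≤ K y x := fun K hK y x => Nat.sInf_le ⟨K, hK, rfl⟩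
  have h2 : ∀ y x m, (∀ K, P K → m ≤ K y x) → m ≤ sInf (S y x) := by
    intro y x m h
    obtain ⟨J, hJ, e⟩ := Nat.sInf_mem (hS y x)
    rw [← e]; exact h J hJ
  refine ⟨fun y x => sInf (S y x), ⟨?_, ?_, ?_, ?_⟩, h1, ?_⟩
  · intro y x h
    obtain ⟨J, hJ⟩ := hne
    have := h1 J hJ y x
    rw [(hP J hJ).out y x h] at this
    omega
  · intro y x
    obtain ⟨J, hJ⟩ := hne
    exact le_trans (h1 J hJ y x) ((hP J hJ).le _ _)
  · intro x y z hxy hyz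
    exact h2 _ _ _ fun K hK => le_trans (h1 K hK _ _) ((hP K hK).mono _ _ _ hxy hyz)
  · intro x y z hxy hyz hpos
    exact h2 _ _ _ fun K hK => le_trans (h1 K hK _ _) ((hP K hK).tr _ _ _ hxy hyz
      (lt_of_lt_of_le hpos (h1 K hK _ _)))
  · intro K hK y x
    exact h2 _ _ _ fun K' hK' => hK K' hK' y x

theorem top_good : GoodInv n s (fun y x => if 1 ≤ x ∧ x < y ∧ y ≤ n then s y else 0) := by
  constructor
  · intro y x h; simp [h]
  · intro y x; split_ifs <;> omega
  · intro x y z h1 h2; split_ifs <;> omega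
  · intro x y z h1 h2; split_ifs <;> omega

end combinatorics

/-! ### From trees to multiplicity functions and back -/

namespace SDecTree

variable {n : ℕ} {s : ℕ → ℕ} {T : SDecTree n s} {x y z a b c j : ℕ}

theorem Descend.one_le (h : T.Descend x y) : 1 ≤ x ∧ x ≤ n ∧ 1 ≤ y ∧ y ≤ n := by
  obtain ⟨k, rfl, hk⟩ := h
  have h0 := hk 0 (Nat.zero_le _)
  have h1 := hk k le_rfl
  simp only [Function.iterate_zero, id] at h0
  exact ⟨h0.1, h0.2, h1.1, h1.2⟩

theorem Descend.refl (h1 : 1 ≤ x) (h2 : x ≤ n) : T.Descend x x :=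
  ⟨0, rfl, fun m hm => by
    have : m = 0 := by omega
    subst this; exact ⟨h1, h2⟩⟩

theorem Descend.trans (h1 : T.Descend x y) (h2 : T.Descend y z) : T.Descend x z := by
  obtain ⟨k, rfl, hk⟩ := h1
  obtain ⟨l, rfl, hl⟩ := h2
  refine ⟨l + k, Function.iterate_add_apply _ _ _ _, fun m hm => ?_⟩
  rcases Nat.lt_or_ge k m with h | h
  · obtain ⟨r, rfl⟩ := Nat.exists_eq_add_of_le h.le
    rw [Nat.add_comm, Function.iterate_add_apply]
    exact hl r (by omega)
  · exact hk m h

theorem descend_parent (T : SDecTree n s) (h1 : 1 ≤ x) (h2 : x < n) :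
    T.Descend x (T.parent x) := by
  have h3 := T.parent_gt x h1 h2
  have h4 := T.parent_le x h1 h2
  refine ⟨1, rfl, fun m hm => ?_⟩
  interval_cases m
  · exact ⟨h1, h2.le⟩
  · simp only [Function.iterate_one]; exact ⟨by omega, h4⟩

theorem Descend.le (h : T.Descend x y) : x ≤ y := by
  obtain ⟨k, rfl, hk⟩ := h
  induction k with
  | zero => exact le_rfl
  | succ k ih =>
    have h1 := ih (fun m hm => hk m (by omega))
    have h2 := hk k (by omega)
    have h3 := hk (k + 1) le_rfl
    rw [Function.iterate_succ_apply'] at h3 ⊢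
    have h4 : T.parent^[k] x < n := by
      by_contra hc
      have := T.parent_out (T.parent^[k] x) (Or.inr (by omega))
      omega
    have := T.parent_gt _ h2.1 h4
    omega

theorem Descend.cons (h : T.Descend x y) (hne : x ≠ y) : x < n ∧ T.Descend (T.parent x) y := by
  have hle := h.le
  have h0 := h.one_le
  obtain ⟨k, rfl, hk⟩ := h
  refine ⟨by omega, ?_⟩
  rcases k with _ | k
  · exact absurd rfl hne
  · refine ⟨k, rfl, fun m hm => ?_⟩
    have := hk (m + 1) (by omega)
    rwa [Function.iterate_succ_apply] at this

theorem Descend.linear (h1 : T.Descend x y) (h2 : T.Descend x z) (hyz : y ≤ z) :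
    T.Descend y z := by
  have hb1 := h1.one_le
  have hb2 := h2.one_le
  obtain ⟨k, rfl, hk⟩ := h1
  obtain ⟨l, rfl, hl⟩ := h2
  have key : ∀ p q, p ≤ q → (∀ m ≤ q, 1 ≤ T.parent^[m] x ∧ T.parent^[m] x ≤ n) →
      T.Descend (T.parent^[p] x) (T.parent^[q] x) := by
    intro p q hpq hq
    obtain ⟨r, rfl⟩ := Nat.exists_eq_add_of_le hpq
    refine ⟨r, ?_, fun m hm => ?_⟩
    · rw [← Function.iterate_add_apply, Nat.add_comm]
    · rw [← Function.iterate_add_apply]; exact hq _ (by omega)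
  rcases Nat.lt_or_ge l k with h | h
  · have h3 := (key l k h.le hk).le
    have h4 : T.parent^[k] x = T.parent^[l] x := le_antisymm hyz h3
    rw [h4]
    exact Descend.refl hb2.2.2.1 hb2.2.2.2
  · exact key k l h hl

/-- `InSub` at a genuine vertex. -/
theorem InSub.facts (h : T.InSub y j x) (hy : 1 ≤ y) :
    ∃ c, T.Descend x c ∧ T.parent c = y ∧ T.idx c = j ∧ 1 ≤ c ∧ c < y ∧ y ≤ n := by
  obtain ⟨c, h1, h2, h3⟩ := h
  have h4 := h1.one_le
  have h5 : c < n := by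
    by_contra hc
    have := T.parent_out c (Or.inr (by omega))
    omega
  have h6 := T.parent_gt c h4.2.2.1 h5
  have h7 := T.parent_le c h4.2.2.1 h5
  exact ⟨c, h1, h2, h3, h4.2.2.1, by omega, by omega⟩

theorem InSub.descend (h : T.InSub y j x) (hy : 1 ≤ y) : T.Descend x y ∧ x < y := by
  obtain ⟨c, h1, h2, h3, h4, h5, h6⟩ := h.facts hy
  have h7 := T.descend_parent h4 (by omega)
  rw [h2] at h7
  have := h1.le
  exact ⟨h1.trans h7, by omega⟩

theorem Descend.inSub (h : T.Descend x y) (hne : x ≠ y) : ∃ j, T.InSub y j x := by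
  obtain ⟨k, hk⟩ : ∃ k, k = y - x := ⟨_, rfl⟩
  induction k using Nat.strong_induction_on generalizing x with
  | _ k ih =>
    obtain ⟨h1, h2⟩ := h.cons hne
    have h0 := h.one_le
    by_cases he : T.parent x = y
    · exact ⟨T.idx x, x, Descend.refl h0.1 h0.2.1, he, rfl⟩
    · have h3 := T.parent_gt x h0.1 h1
      have h4 := h2.le
      obtain ⟨j, c, h5, h6⟩ := ih (y - T.parent x) (by omega) h2 he rfl
      exact ⟨j, c, (T.descend_parent h0.1 h1).trans h5, h6⟩

theorem InSub.unique {i : ℕ} (h : T.InSub y j x) (h' : T.InSub y i x) : j = i := by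
  rcases Nat.eq_zero_or_pos y with rfl | hy
  · have key : ∀ c, T.Descend x c → T.parent c = 0 → c = n := by
      intro c h1 h2
      have h3 := h1.one_le
      by_contra hc
      have := T.parent_gt c h3.2.2.1 (by omega)
      omega
    obtain ⟨c, h1, h2, h3⟩ := h
    obtain ⟨c', h1', h2', h3'⟩ := h'
    rw [← h3, ← h3', key c h1 h2, key c' h1' h2']
  · obtain ⟨c, h1, h2, h3, h4, h5, h6⟩ := h.facts hy
    obtain ⟨c', h1', h2', h3', h4', h5', h6'⟩ := h'.facts hy
    have key : ∀ c c', T.Descend x c → T.Descend x c' → T.parent c = y → c' < y → c ≤ c' →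
        c = c' := by
      intro c c' h1 h2 h3 h4 h5
      by_contra hc
      have := ((h1.linear h2 h5).cons hc).2.le
      omega
    have : c = c' := by
      rcases le_total c c' with h | h
      · exact key c c' h1 h1' h2 h5' h
      · exact (key c' c h1' h1 h2' h5 h).symm
    subst this
    rw [← h3, ← h3']

theorem InSub.card_eq (h : T.InSub y j x) : T.card y x = j := by
  have hex : ∃ j, T.InSub y j x := ⟨j, h⟩
  unfold card
  rw [dif_pos hex]
  exact hex.choose_spec.unique h

theorem Descend.inSub_of (h : T.Descend a b) (h' : T.InSub c j b) : T.InSub c j a := by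
  obtain ⟨e, h1, h2, h3⟩ := h'
  exact ⟨e, h.trans h1, h2, h3⟩

/-- Two incomparable vertices are separated at their least common ancestor. -/
theorem exists_sep (h1 : 1 ≤ a) (hab : a < b) (hb : b ≤ n) (h : ¬ T.Descend a b) :
    ∃ z j₁ j₂, b < z ∧ z ≤ n ∧ T.InSub z j₁ a ∧ T.InSub z j₂ b ∧ j₁ ≠ j₂ := by
  have key : ∀ k a, k = n - a → 1 ≤ a → a ≤ n → ¬ T.Descend a b → ¬ T.Descend b a →
      ∃ z j₁ j₂, b < z ∧ z ≤ n ∧ T.InSub z j₁ a ∧ T.InSub z j₂ b ∧ j₁ ≠ j₂ := by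
    intro k
    induction k using Nat.strong_induction_on with
    | _ k ih =>
      intro a hk h1 han hd hd'
      have han' : a < n := by
        by_contra hc
        have : a = n := by omega
        subst this
        apply hd'
        have key2 : ∀ k b, k = a - b → 1 ≤ b → b ≤ a → T.Descend b a := by
          intro k
          induction k using Nat.strong_induction_on with
          | _ k ih =>
            intro b hk h1 h2
            by_cases hba : b = a
            · subst hba; exact Descend.refl h1 h2
            · have h3 := T.parent_gt b h1 (by omega)
              have h4 := T.parent_le b h1 (by omega)
              exact (T.descend_parent h1 (by omega)).trans
                (ih (a - T.parent b) (by omega) _ rfl (by omega) h4)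
        exact key2 _ b rfl (by omega) hb
      have hp := T.descend_parent h1 han'
      have hg := T.parent_gt a h1 han'
      have hl := T.parent_le a h1 han'
      have hpd : ¬ T.Descend (T.parent a) b := fun hc => hd (hp.trans hc)
      have hself : T.Descend a a := Descend.refl h1 han
      by_cases hbp : T.Descend b (T.parent a)
      · have hne : b ≠ T.parent a := by
          rintro h5
          exact hpd (h5 ▸ hbp)
        obtain ⟨j, hj⟩ := hbp.inSub hne
        have := hbp.le
        refine ⟨T.parent a, T.idx a, j, by omega, hl, ⟨a, hself, rfl, rfl⟩, hj, ?_⟩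
        rintro rfl
        obtain ⟨c, h6, h7, h8, h9, h10, h11⟩ := hj.facts (by omega)
        have := T.slot_inj a c h1 han' h9 (by omega) h7.symm h8.symm
        subst this
        exact hd' h6
      · obtain ⟨z, j₁, j₂, h5, h5', h6, h7, h8⟩ :=
          ih (n - T.parent a) (by omega) _ rfl (by omega) hl hpd hbp
        exact ⟨z, j₁, j₂, h5, h5', hp.inSub_of h6, h7, h8⟩
  exact key _ a rfl h1 (by omega) h (fun hc => by have := hc.le; omega)

theorem leftOf_of_tamari (hT : T.IsTamari) (h1 : 1 ≤ a) (hab : a < b) (hb : b ≤ n)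
    (h : ¬ T.Descend a b) :
    ∃ z j₁ j₂, b < z ∧ z ≤ n ∧ T.InSub z j₁ a ∧ T.InSub z j₂ b ∧ j₁ < j₂ := by
  obtain ⟨z, j₁, j₂, h2, h3, h4, h5, h6⟩ := exists_sep h1 hab hb h
  refine ⟨z, j₁, j₂, h2, h3, h4, h5, ?_⟩
  have := hT a b z hab h2
  rw [h4.card_eq, h5.card_eq] at this
  omega

theorem card_of_not (hT : T.IsTamari) (h : ¬ ∃ j, T.InSub y j x) : T.card y x = 0 := by
  unfold card
  rw [dif_neg h, if_neg]
  rintro ⟨h1, h2, h3, h4⟩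
  have h5 : ¬ T.Descend x y := fun hc => h (hc.inSub (by omega))
  obtain ⟨z, j₁, j₂, h6, h7, h8, h9, h10⟩ := leftOf_of_tamari hT h1 h2 h3 h5
  exact h4 ⟨z, j₁, j₂, h10, h8, h9⟩

theorem card_zero_left (T : SDecTree n s) : T.card 0 x = 0 := by
  by_cases h : ∃ j, T.InSub 0 j x
  · obtain ⟨j, hj⟩ := h
    rw [hj.card_eq]
    obtain ⟨c, h1, h2, h3⟩ := hj
    have h4 := h1.one_le
    have : c = n := by
      by_contra hc
      have := T.parent_gt c h4.2.2.1 (by omega)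
      omega
    rw [← h3, T.idx_out c (Or.inr (by omega))]
  · unfold card
    rw [dif_neg h, if_neg (by omega)]

theorem card_anc (hT : T.IsTamari) (h : T.Descend a b) : AncInv T.card a b := by
  intro c hc
  by_cases hb : ∃ j, T.InSub c j b
  · obtain ⟨j, hj⟩ := hb
    rw [hj.card_eq, (h.inSub_of hj).card_eq]
  · rw [card_of_not hT hb, card_of_not hT]
    rintro ⟨j, hj⟩
    apply hb
    have h1 := (hj.descend (by omega)).1
    exact (h.linear h1 hc.le).inSub (by omega)

theorem card_good (hT : T.IsTamari) : GoodInv n s T.card := by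
  refine ⟨?_, ?_, hT, ?_⟩
  · intro y x h
    rcases Nat.eq_zero_or_pos y with rfl | hy
    · exact card_zero_left T
    · apply card_of_not hT
      rintro ⟨j, hj⟩
      obtain ⟨h1, h2⟩ := hj.descend hy
      have := h1.one_le
      omega
  · intro y x
    rcases Nat.eq_zero_or_pos y with rfl | hy
    · rw [card_zero_left T]; omega
    · by_cases h : ∃ j, T.InSub y j x
      · obtain ⟨j, hj⟩ := h
        rw [hj.card_eq]
        obtain ⟨c, h1, h2, h3, h4, h5, h6⟩ := hj.facts hy
        have := T.idx_le c h4 (by omega)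
        rwa [h2, h3] at this
      · rw [card_of_not hT h]; omega
  · intro a b c hab hbc hp
    by_cases h : ∃ j, T.InSub b j a
    · obtain ⟨j, hj⟩ := h
      exact (card_anc hT (hj.descend (by omega)).1 c hbc).symm.le
    · rw [card_of_not hT h] at hp; omega

theorem card_parent (h1 : 1 ≤ a) (h2 : a < n) : T.card (T.parent a) a = T.idx a :=
  InSub.card_eq ⟨a, Descend.refl h1 h2.le, rfl, rfl⟩

theorem parInv_parent (hT : T.IsTamari) (h1 : 1 ≤ a) (h2 : a < n) :
    ParInv n T.card a (T.parent a) := by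
  have h3 := T.parent_gt a h1 h2
  have h4 := T.parent_le a h1 h2
  refine ⟨h3, h4, card_anc hT (T.descend_parent h1 h2), fun y h5 h6 h7 => ?_⟩
  have h8 : ¬ T.Descend a y := by
    intro hc
    have := (hc.cons (by omega)).2.le
    omega
  obtain ⟨z, j₁, j₂, h9, h10, h11, h12, h13⟩ := leftOf_of_tamari hT h1 h5 (by omega) h8
  have := h7 z h9
  rw [h11.card_eq, h12.card_eq] at this
  omega

theorem tamari_ext {Z : SDecTree n s} (hT : T.IsTamari) (hZ : Z.IsTamari)
    (h : ∀ y x, T.card y x = Z.card y x) : T = Z := by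
  have hc : T.card = Z.card := funext fun y => funext fun x => h y x
  have hp : ∀ v, T.parent v = Z.parent v := by
    intro v
    by_cases hv : 1 ≤ v ∧ v < n
    · have h1 := parInv_parent hT hv.1 hv.2
      rw [hc] at h1
      exact h1.unique (parInv_parent hZ hv.1 hv.2)
    · rw [T.parent_out v (by omega), Z.parent_out v (by omega)]
  have hi : ∀ v, T.idx v = Z.idx v := by
    intro v
    by_cases hv : 1 ≤ v ∧ v < n
    · rw [← card_parent hv.1 hv.2, ← card_parent hv.1 hv.2, hp, hc]
    · rw [T.idx_out v (by omega), Z.idx_out v (by omega)]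
  have h1 : T.parent = Z.parent := funext hp
  have h2 : T.idx = Z.idx := funext hi
  cases T; cases Z
  simp only at h1 h2
  subst h1 h2
  rfl

/-- Every good multiplicity function comes from an `s`-Tamari tree. -/
theorem exists_tree {I : ℕ → ℕ → ℕ} (hg : GoodInv n s I) :
    ∃ T : SDecTree n s, T.IsTamari ∧ T.card = I := by
  have hex : ∀ a, ∃ b, (1 ≤ a ∧ a < n → ParInv n I a b) ∧ (¬ (1 ≤ a ∧ a < n) → b = 0) := by
    intro a
    by_cases ha : 1 ≤ a ∧ a < n
    · obtain ⟨b, hb⟩ := exists_parInv I hg ha.2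
      exact ⟨b, fun _ => hb, fun h => absurd ha h⟩
    · exact ⟨0, fun h => absurd h ha, fun _ => rfl⟩
  choose p hp hp0 using hex
  have hpar : ∀ v, 1 ≤ v → v < n → ParInv n I v (p v) := fun v h1 h2 => hp v ⟨h1, h2⟩
  let T : SDecTree n s :=
    { parent := p
      idx := fun v => if 1 ≤ v ∧ v < n then I (p v) v else 0
      parent_gt := fun v h1 h2 => (hpar v h1 h2).lt
      parent_le := fun v h1 h2 => (hpar v h1 h2).le
      idx_le := fun v h1 h2 => by rw [if_pos ⟨h1, h2⟩]; exact hg.le _ _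
      slot_inj := by
        intro v w h1 h2 h3 h4 h5 h6
        rw [if_pos ⟨h1, h2⟩, if_pos ⟨h3, h4⟩] at h6
        have hv := hpar v h1 h2
        have hw := hpar w h3 h4
        rcases lt_trichotomy v w with h | h | h
        · have := hv.slt hg h (h5 ▸ hw.lt)
          rw [h5] at this h6; omega
        · exact h
        · have := hw.slt hg h (h5 ▸ hv.lt)
          rw [h5] at h6; omega
      parent_out := fun v h => hp0 v (by omega)
      idx_out := fun v h => by rw [if_neg (by omega)] }
  have hTp : ∀ v, T.parent v = p v := fun v => rfl
  have hTi : ∀ v, 1 ≤ v → v < n → T.idx v = I (p v) v := fun v h1 h2 => if_pos ⟨h1, h2⟩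
  have hd1 : ∀ x y, T.Descend x y → AncInv I x y := by
    intro x y h
    obtain ⟨k, hk⟩ : ∃ k, k = y - x := ⟨_, rfl⟩
    induction k using Nat.strong_induction_on generalizing x with
    | _ k ih =>
      by_cases hne : x = y
      · subst hne; exact fun c _ => rfl
      · obtain ⟨h1, h2⟩ := h.cons hne
        have h0 := h.one_le
        have h3 := hpar x h0.1 h1
        have h4 := h2.le
        have h5 := h3.lt
        rw [hTp] at h2 h4
        exact h3.anc.trans (ih (y - p x) (by omega) (p x) h2 rfl) h4
  have hd2 : ∀ k x y, k = y - x → 1 ≤ x → x ≤ y → y ≤ n → AncInv I x y → T.Descend x y := by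
    intro k
    induction k using Nat.strong_induction_on with
    | _ k ih =>
      intro x y hk h1 h2 h3 h4
      by_cases hne : x = y
      · subst hne; exact Descend.refl h1 h3
      · have h5 := hpar x h1 (by omega)
        have h6 := h5.le_of_anc h4 (by omega)
        have h7 := h5.lt
        refine (T.descend_parent h1 (by omega)).trans ?_
        rw [hTp]
        refine ih (y - p x) (by omega) (p x) y rfl (by omega) h6 h3 ?_
        intro c hc
        rw [← h5.anc c (by omega), h4 c hc]
  have hs1 : ∀ y j x, 1 ≤ y → T.InSub y j x → I y x = j := by
    intro y j x hy h
    obtain ⟨c, h1, h2, h3, h4, h5, h6⟩ := h.facts hy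
    rw [hd1 x c h1 y h5, ← h3, hTi c h4 (by omega), ← h2, hTp]
  have hs2 : ∀ y x, 1 ≤ x → x < y → y ≤ n → AncInv I x y → T.InSub y (I y x) x := by
    intro y x h1 h2 h3 h4
    obtain ⟨j, hj⟩ := (hd2 _ x y rfl h1 h2.le h3 h4).inSub (by omega)
    rw [hs1 y j x (by omega) hj]
    exact hj
  have hcard : T.card = I := by
    funext y x
    rcases Nat.eq_zero_or_pos y with rfl | hy
    · rw [card_zero_left, hg.out]; omega
    · by_cases h : ∃ j, T.InSub y j x
      · obtain ⟨j, hj⟩ := h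
        rw [hj.card_eq, hs1 y j x hy hj]
      · by_cases hr : 1 ≤ x ∧ x < y ∧ y ≤ n
        · have hna : ¬ AncInv I x y := fun hc => h ⟨_, hs2 y x hr.1 hr.2.1 hr.2.2 hc⟩
          have hI0 : I y x = 0 := by
            by_contra hc
            exact hna (hg.pos_anc (by omega))
          rw [hI0]
          unfold card
          rw [dif_neg h, if_neg]
          rintro ⟨-, -, -, hl⟩
          apply hl
          have key : ∀ k z, k = n - z → y < z → I z x ≠ I z y → T.LeftOf x y := by
            intro k
            induction k using Nat.strong_induction_on with
            | _ k ih =>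
              intro z hk hz hne
              have hm := hg.mono x y z hr.2.1 hz
              have hpos : 0 < I z y := by omega
              have hz3 := hg.one_le hpos
              have hyz := hg.pos_anc hpos
              by_cases hxz : AncInv I x z
              · exact ⟨z, I z x, I z y, by omega, hs2 z x hr.1 (by omega) hz3.2.2 hxz,
                  hs2 z y hz3.1 hz hz3.2.2 hyz⟩
              · unfold AncInv at hxz
                push Not at hxz
                obtain ⟨w, hw, hwne⟩ := hxz
                have hwne' : I w x ≠ I w y := by rw [hyz w hw]; exact hwne
                have hwp : 0 < I w y := by
                  have := hg.mono x y w hr.2.1 (by omega)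
                  omega
                have := hg.one_le hwp
                exact ih (n - w) (by omega) w rfl (by omega) hwne'
          unfold AncInv at hna
          push Not at hna
          obtain ⟨z, hz, hne⟩ := hna
          exact key _ z rfl hz hne
        · rw [hg.out y x hr]
          unfold card
          rw [dif_neg h, if_neg (by tauto)]
  refine ⟨T, ?_, hcard⟩
  intro a b c h1 h2
  rw [hcard]
  exact hg.mono a b c h1 h2

end SDecTree

/-! ### The SB-labeling property -/

section doubleRotation

variable {n : ℕ} {s : ℕ → ℕ} {u X : ℕ → ℕ → ℕ} {a b c d e f x y : ℕ}

theorem double_lt (hg : GoodInv n s u) (hcd : c < d)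
    (h : u y x < rotInv (rotInv u a b) c d y x) :
    (y = b ∧ (x = a ∨ 0 < u a x)) ∨
      (y = d ∧ (x = c ∨ 0 < u c x ∨ (b = c ∧ (x = a ∨ 0 < u a x)))) := by
  by_cases h1 : y = b ∧ (x = a ∨ 0 < u a x)
  · exact Or.inl h1
  · right
    have h2 : rotInv u a b y x = u y x := by simp only [rotInv, if_neg h1]
    by_cases h3 : y = d ∧ (x = c ∨ 0 < rotInv u a b c x)
    · refine ⟨h3.1, ?_⟩
      rcases h3.2 with h4 | h4
      · exact Or.inl h4
      · right
        by_cases h5 : c = b ∧ (x = a ∨ 0 < u a x)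
        · exact Or.inr ⟨h5.1.symm, h5.2⟩
        · left
          simpa only [rotInv, if_neg h5] using h4
    · rw [rotInv, if_neg h3, h2] at h
      omega

theorem double_dc (hg : GoodInv n s u) (hac : a < c) :
    rotInv (rotInv u a b) c d d c = u d c + 1 := by
  rw [rot_self, rot_not]
  rintro (h | h)
  · omega
  · have := hg.one_le h; omega

theorem double_ba (hg : GoodInv n s u) (hp : ParInv n u a b) (hac : a < c) (hcd : c < d) :
    rotInv (rotInv u a b) c d b a ≤ u b a + 1 := by
  rw [rotInv]
  split_ifs with h
  · exfalso
    obtain ⟨rfl, h⟩ := h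
    rcases h with h | h
    · omega
    · rw [rot_ne (by omega)] at h
      have := hp.le_of_pos hg h
      omega
  · rw [rot_self]

theorem edge_cases (hg : GoodInv n s u) (hX : GoodInv n s X) (hle : ∀ y x, u y x ≤ X y x)
    (hab : a < b) (hac : a < c) (hcd : c < d) (hp : ParInv n X e f)
    (h : X f e < rotInv (rotInv u a b) c d f e) :
    (e = a ∧ f = b) ∨ (e = c ∧ f = d) ∨ (e = a ∧ f = d ∧ b = c) := by
  have key : ∀ z, 0 < u z e → f ≤ z := fun z hz =>
    hp.le_of_pos hX (lt_of_lt_of_le hz (hle z e))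
  rcases double_lt hg hcd (lt_of_le_of_lt (hle f e) h) with
    ⟨h1, h2 | h2⟩ | ⟨h1, h2 | h2 | ⟨h2, h3 | h3⟩⟩
  · exact Or.inl ⟨h2, h1⟩
  · have := key a h2; omega
  · exact Or.inr (Or.inl ⟨h2, h1⟩)
  · have := key c h2; omega
  · exact Or.inr (Or.inr ⟨h3, h1, h2⟩)
  · have := key a h3; omega

end doubleRotation

section chains

variable {α : Type*} {R le : α → α → Prop} {lab : α → α → ℕ}

theorem chain_head_le (hr : ∀ x, le x x) (ht : ∀ x y z, le x y → le y z → le x z)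
    (hR : ∀ x y, R x y → le x y) {j : α} :
    ∀ (L : List α) (x : α), List.IsChain R L → L.head? = some x → L.getLast? = some j → le x j := by
  intro L
  induction L with
  | nil => intro x _ h; simp at h
  | cons y L ih =>
    intro x hc hh hl
    simp only [List.head?_cons, Option.some.injEq] at hh
    subst hh
    cases L with
    | nil =>
      simp only [List.getLast?_singleton, Option.some.injEq] at hl
      subst hl; exact hr _
    | cons z L =>
      rw [List.isChain_cons_cons] at hc
      rw [List.getLast?_cons_cons] at hl
      exact ht _ _ _ (hR _ _ hc.1) (ih z hc.2 rfl hl)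

theorem chain_inv (hr : ∀ x, le x x) (ht : ∀ x y z, le x y → le y z → le x z)
    (hR : ∀ x y, R x y → le x y) {j : α} (Inv : α → Prop) (G Q : ℕ → Prop)
    (hstep : ∀ x y, R x y → le y j → Inv x → G (lab x y) → Inv y ∧ Q (lab x y)) :
    ∀ (L : List α) (x : α), List.IsChain R L → L.head? = some x → L.getLast? = some j →
      Inv x → (∀ l ∈ labelsOf lab L, G l) → Inv j ∧ ∀ l ∈ labelsOf lab L, Q l := by
  intro L
  induction L with
  | nil => intro x _ h; simp at h
  | cons y L ih =>
    intro x hc hh hl hx hG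
    simp only [List.head?_cons, Option.some.injEq] at hh
    subst hh
    cases L with
    | nil =>
      simp only [List.getLast?_singleton, Option.some.injEq] at hl
      subst hl
      exact ⟨hx, fun l hl => by simp [labelsOf] at hl⟩
    | cons z L =>
      rw [List.isChain_cons_cons] at hc
      rw [List.getLast?_cons_cons] at hl
      have he : labelsOf lab (y :: z :: L) = lab y z :: labelsOf lab (z :: L) := rfl
      rw [he] at hG ⊢
      have hzj := chain_head_le hr ht hR _ z hc.2 rfl hl
      obtain ⟨h1, h2⟩ := hstep y z hc.1 hzj hx (hG _ List.mem_cons_self)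
      obtain ⟨h3, h4⟩ := ih z hc.2 rfl hl h1 (fun l hl => hG l (List.mem_cons_of_mem _ hl))
      refine ⟨h3, fun l hl => ?_⟩
      rcases List.mem_cons.1 hl with rfl | hl
      · exact h2
      · exact h4 l hl

end chains

namespace SDecTree

variable {n : ℕ} {s : ℕ → ℕ} {T Z : SDecTree n s} {a b c : ℕ}

theorem TamariAscent.par (h : T.TamariAscent a b) (hT : T.IsTamari) : ParInv n T.card a b := by
  obtain ⟨h1, h2, rfl, -⟩ := h
  exact parInv_parent hT h1 h2

theorem TamariAscent.good_rot (h : T.TamariAscent a b) (hT : T.IsTamari) :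
    GoodInv n s (rotInv T.card a b) :=
  rot_good (card_good hT) h.1 (h.par hT) h.2.2.2

theorem tamrot_le (hT : T.IsTamari) (h : IsTamRotation T Z a b) :
    T.card b a + 1 ≤ Z.card b a := by
  obtain ⟨h1, h2⟩ := h
  have hp := h1.par hT
  have hg := card_good hT
  rw [h2 b a h1.1 hp.lt hp.le]
  unfold tcInv
  have hne : {m | ∃ J : ℕ → ℕ → ℕ, IsTransitiveInv J ∧
      (∀ y' x', addInv s T.card b a y' x' ≤ J y' x') ∧ J b a = m}.Nonempty := by
    refine ⟨s b, fun y _ => s y, fun _ _ _ _ _ => Or.inr le_rfl, fun y x => ?_, rfl⟩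
    unfold addInv
    split_ifs
    · exact min_le_right _ _
    · exact hg.le _ _
  obtain ⟨J, hJ1, hJ2, hJ3⟩ := Nat.sInf_mem hne
  rw [← hJ3]
  refine le_trans ?_ (hJ2 b a)
  have := h1.2.2.2
  simp only [addInv, and_self, if_true]
  omega

theorem tamcov_card (hc : tamcov T Z) (h : IsTamRotation T Z a b) :
    Z.card = rotInv T.card a b := by
  obtain ⟨hT, hZ, hlt, hmin⟩ := hc
  obtain ⟨R, hR, hRc⟩ := exists_tree (h.1.good_rot hT)
  have hp := h.1.par hT
  have hRZ : wle R Z := fun y x => by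
    rw [hRc]
    exact rot_le (card_good hT) (card_good hZ) hlt.1 hp.lt (tamrot_le hT h)
  have hTR : wlt T R := by
    refine ⟨fun y x => by rw [hRc]; exact le_rot (card_good hT) hp.lt, fun hc => ?_⟩
    have := hc b a
    rw [hRc, rot_self] at this
    omega
  have hZR : wle Z R := by
    by_contra hc
    exact hmin R hR hTR ⟨hRZ, hc⟩
  rw [← hRc]
  funext y x
  exact le_antisymm (hZR y x) (hRZ y x)

theorem wle_refl' (T : SDecTree n s) : wle T T := fun _ _ => le_rfl

theorem wle_trans' {T Y Z : SDecTree n s} (h1 : wle T Y) (h2 : wle Y Z) : wle T Z :=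
  fun y x => (h1 y x).trans (h2 y x)

/-- The SB-property, for two covers with ordered labels. -/
theorem sb_ordered (lab : SDecTree n s → SDecTree n s → ℕ)
    (hlab : ∀ T Z : SDecTree n s, tamcov T Z →
      ∃ b, T.TamariAscent (lab T Z) b ∧ IsTamRotation T Z (lab T Z) b)
    (u v w : SDecTree n s) (huv : tamcov u v) (huw : tamcov u w) (hlt : lab u v < lab u w)
    (j : SDecTree n s) (hj : IsTamJoin v w j) (L : List (SDecTree n s))
    (hL : List.IsChain tamcov L) (hh : L.head? = some u) (hl : L.getLast? = some j) :
    (lab u v ∈ labelsOf lab L ∧ lab u w ∈ labelsOf lab L) ∧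
      ∀ l ∈ labelsOf lab L, l = lab u v ∨ l = lab u w := by
  obtain ⟨b, hasc, hrot⟩ := hlab u v huv
  obtain ⟨d, hasc', hrot'⟩ := hlab u w huw
  have hv := tamcov_card huv hrot
  have hw := tamcov_card huw hrot'
  generalize lab u v = a at *
  generalize lab u w = c at *
  have hu := huv.1
  have hg := card_good hu
  have hpa := hasc.par hu
  have hpc := hasc'.par hu
  have hab := hpa.lt
  have hcd := hpc.lt
  have hvg : GoodInv n s (rotInv u.card a b) := hasc.good_rot hu
  have hpcv : ParInv n (rotInv u.card a b) c d := rot_par hpa hg hlt hpc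
  have hvdc : rotInv u.card a b d c = u.card d c := by
    have := double_dc (b := b) (d := d) hg hlt
    rw [rot_self] at this
    omega
  have hMg : GoodInv n s (rotInv (rotInv u.card a b) c d) :=
    rot_good hvg hasc'.1 hpcv (by rw [hvdc]; exact hasc'.2.2.2)
  obtain ⟨M, hM, hMc⟩ := exists_tree hMg
  have hvM : ∀ y x, v.card y x ≤ M.card y x := fun y x => by
    rw [hv, hMc]; exact le_rot hvg hcd
  have huM : ∀ y x, u.card y x ≤ M.card y x := fun y x => (huv.2.2.1.1 y x).trans (hvM y x)
  have hwM : ∀ y x, w.card y x ≤ M.card y x := fun y x => by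
    rw [hw]
    refine rot_le hg (card_good hM) huM hcd ?_
    rw [hMc, double_dc hg hlt]
  have hjM : wle j M := hj.2.2.2 M hM hvM hwM
  have hR : ∀ x y : SDecTree n s, tamcov x y → wle x y := fun x y h => h.2.2.1.1
  -- analysis of an edge of the chain
  have edge : ∀ x y : SDecTree n s, tamcov x y → wle y j → wle u x → ∃ f,
      y.card = rotInv x.card (lab x y) f ∧ ParInv n x.card (lab x y) f ∧
      x.card f (lab x y) < M.card f (lab x y) ∧
      ((lab x y = a ∧ f = b) ∨ (lab x y = c ∧ f = d) ∨ (lab x y = a ∧ f = d ∧ b = c)) := by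
    intro x y hxy hyj hux
    obtain ⟨f, h1, h2⟩ := hlab x y hxy
    have h3 := tamcov_card hxy h2
    have h4 := h1.par hxy.1
    have h5 : x.card f (lab x y) < M.card f (lab x y) := by
      have := (hyj f (lab x y)).trans (hjM f (lab x y))
      rw [h3, rot_self] at this
      omega
    refine ⟨f, h3, h4, h5, ?_⟩
    rw [hMc] at h5
    exact edge_cases hg (card_good hxy.1) hux hab hlt hcd h4 h5
  refine ⟨⟨?_, ?_⟩, ?_⟩
  · by_contra hna
    have hKg : GoodInv n s (capInv n s a b (u.card b a)) := cap_good hasc.2.2.2.le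
    have h := chain_inv (le := wle) (lab := lab) wle_refl' (fun _ _ _ => wle_trans') hR (j := j)
      (fun x => wle u x ∧ ∀ q p, x.card q p ≤ capInv n s a b (u.card b a) q p)
      (fun l => l ≠ a) (fun _ => True) ?_ L u hL hh hl
      ⟨wle_refl' u, fun q p => le_cap hg hpa⟩ (fun l hl he => hna (he ▸ hl))
    · have h1 := h.1.2 b a
      rw [cap_self hasc.1 hab hpa.le] at h1
      have h2 := hj.2.1 b a
      rw [hv, rot_self] at h2
      omega
    · intro x y hxy hyj hx hne
      refine ⟨⟨wle_trans' hx.1 (hR x y hxy), ?_⟩, trivial⟩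
      obtain ⟨f, h1, h2, h3, h4⟩ := edge x y hxy hyj hx.1
      rcases h4 with h4 | ⟨h4, rfl⟩ | h4
      · exact absurd h4.1 hne
      · intro q p
        rw [h1, h4]
        refine rot_le (card_good hxy.1) hKg hx.2 hcd ?_
        rw [h4, hMc, double_dc hg hlt] at h3
        have := cap_rot hg hasc'.1 hpc hasc'.2.2.2 hpa (by omega)
        omega
      · exact absurd h4.1 hne
  · by_contra hna
    have hKg : GoodInv n s (capInv n s c d (u.card d c)) := cap_good hasc'.2.2.2.le
    have h := chain_inv (le := wle) (lab := lab) wle_refl' (fun _ _ _ => wle_trans') hR (j := j)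
      (fun x => wle u x ∧ ∀ q p, x.card q p ≤ capInv n s c d (u.card d c) q p)
      (fun l => l ≠ c) (fun _ => True) ?_ L u hL hh hl
      ⟨wle_refl' u, fun q p => le_cap hg hpc⟩ (fun l hl he => hna (he ▸ hl))
    · have h1 := h.1.2 d c
      rw [cap_self hasc'.1 hcd hpc.le] at h1
      have h2 := hj.2.2.1 d c
      rw [hw, rot_self] at h2
      omega
    · intro x y hxy hyj hx hne
      refine ⟨⟨wle_trans' hx.1 (hR x y hxy), ?_⟩, trivial⟩
      obtain ⟨f, h1, h2, h3, h4⟩ := edge x y hxy hyj hx.1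
      rcases h4 with ⟨h4, rfl⟩ | h4 | ⟨h4, rfl, rfl⟩
      · intro q p
        rw [h1, h4]
        refine rot_le (card_good hxy.1) hKg hx.2 hab ?_
        rw [h4, hMc] at h3
        have h5 := double_ba hg hpa hlt hcd
        have := cap_rot hg hasc.1 hpa hasc.2.2.2 hpc (by omega)
        omega
      · exact absurd h4.1 hne
      · exfalso
        rw [h4] at h2
        have hxM : wle x M := wle_trans' (hR x y hxy) (wle_trans' hyj hjM)
        have hanc : AncInv x.card a b := by
          intro z hz
          by_cases hzf : z = f
          · subst hzf
            have h5 := hx.2 z b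
            rw [cap_self hasc'.1 hcd hpc.le] at h5
            have h6 := (card_good hxy.1).mono a b z hlt hcd
            have h7 := hpa.anc z hz
            have h8 := hx.1 z a
            omega
          · have h9 : ∀ q, x.card z q = u.card z q := by
              intro q
              refine le_antisymm ?_ (hx.1 z q)
              by_contra hc
              have h10 : u.card z q < rotInv (rotInv u.card a b) b f z q := by
                have := hxM z q
                rw [hMc] at this
                omega
              rcases double_lt hg hcd h10 with h11 | h11
              · omega
              · exact hzf h11.1
            rw [h9, h9, hpa.anc z hz]
        have := h2.le_of_anc hanc hlt
        omega
  · refine (chain_inv (le := wle) (lab := lab) wle_refl' (fun _ _ _ => wle_trans') hR (j := j)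
      (fun x => wle u x) (fun _ => True) (fun l => l = a ∨ l = c) ?_ L u hL hh hl
      (wle_refl' u) (fun _ _ => trivial)).2
    intro x y hxy hyj hx _
    refine ⟨wle_trans' hx (hR x y hxy), ?_⟩
    obtain ⟨f, h1, h2, h3, h4⟩ := edge x y hxy hyj hx
    rcases h4 with h4 | h4 | h4
    · exact Or.inl h4.1
    · exact Or.inr h4.1
    · exact Or.inl h4.1

theorem sb_part (lab : SDecTree n s → SDecTree n s → ℕ)
    (hlab : ∀ T Z : SDecTree n s, tamcov T Z →
      ∃ b, T.TamariAscent (lab T Z) b ∧ IsTamRotation T Z (lab T Z) b)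
    (u v w : SDecTree n s) (huv : tamcov u v) (huw : tamcov u w) (hne : v ≠ w)
    (j : SDecTree n s) (hj : IsTamJoin v w j) :
    lab u v ≠ lab u w ∧
      ∀ L : List (SDecTree n s), List.IsChain tamcov L →
        L.head? = some u → L.getLast? = some j →
        (lab u v ∈ labelsOf lab L ∧ lab u w ∈ labelsOf lab L) ∧
        ∀ l ∈ labelsOf lab L, l = lab u v ∨ l = lab u w := by
  have hlne : lab u v ≠ lab u w := by
    intro he
    obtain ⟨b, hasc, hrot⟩ := hlab u v huv
    obtain ⟨d, hasc', hrot'⟩ := hlab u w huw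
    have hv := tamcov_card huv hrot
    have hw := tamcov_card huw hrot'
    have hbd : b = d := by
      rw [← hasc.2.2.1, ← hasc'.2.2.1, he]
    apply hne
    apply tamari_ext huv.2.1 huw.2.1
    intro y x
    rw [hv, hw, he, hbd]
  refine ⟨hlne, fun L hL hh hl => ?_⟩
  rcases lt_or_gt_of_ne hlne with h | h
  · exact sb_ordered lab hlab u v w huv huw h j hj L hL hh hl
  · have hj' : IsTamJoin w v j := ⟨hj.1, hj.2.2.1, hj.2.1, fun U h1 h2 h3 => hj.2.2.2 U h1 h3 h2⟩
    obtain ⟨⟨h1, h2⟩, h3⟩ := sb_ordered lab hlab u w v huw huv h j hj' L hL hh hl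
    exact ⟨⟨h2, h1⟩, fun l hl => (h3 l hl).symm⟩

end SDecTree

/-! ### Order complexes of finite posets -/

section orderComplexes

/-- The geometric realization of the order complex of a finite poset. -/
def OC (P : Type*) [Fintype P] [PartialOrder P] : Set (P → ℝ) :=
  {f | (∀ x, 0 ≤ f x) ∧ (∀ x y, f x ≠ 0 → f y ≠ 0 → x ≤ y ∨ y ≤ x) ∧ ∑ x, f x = 1}

variable {P Q R : Type*} [Fintype P] [PartialOrder P] [Fintype Q] [PartialOrder Q]
  [Fintype R] [PartialOrder R]

/-- Push part `l` of a mass distribution along `φ` and part `r` along `ψ`. -/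
noncomputable def mixOC (φ ψ : P → Q) (l r : P → ℝ) (q : Q) : ℝ :=
  ∑ x, ((if φ x = q then l x else 0) + (if ψ x = q then r x else 0))

theorem mixOC_mem {φ ψ : P → Q} (hφ : Monotone φ) (hψ : Monotone ψ) (hle : ∀ x, φ x ≤ ψ x)
    {l r : P → ℝ} (hl : ∀ x, 0 ≤ l x) (hr : ∀ x, 0 ≤ r x) (hsum : ∑ x, (l x + r x) = 1)
    (hll : ∀ x y, l x ≠ 0 → l y ≠ 0 → x ≤ y ∨ y ≤ x)
    (hrr : ∀ x y, r x ≠ 0 → r y ≠ 0 → x ≤ y ∨ y ≤ x)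
    (hlr : ∀ x y, l x ≠ 0 → r y ≠ 0 → x ≤ y) : mixOC φ ψ l r ∈ OC Q := by
  refine ⟨fun q => ?_, ?_, ?_⟩
  · refine Finset.sum_nonneg fun x _ => add_nonneg ?_ ?_
    · split_ifs <;> simp [hl]
    · split_ifs <;> simp [hr]
  · have key : ∀ q, mixOC φ ψ l r q ≠ 0 →
        (∃ x, φ x = q ∧ l x ≠ 0) ∨ (∃ x, ψ x = q ∧ r x ≠ 0) := by
      intro q hq
      obtain ⟨x, -, hx⟩ := Finset.exists_ne_zero_of_sum_ne_zero hq
      by_contra hc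
      push Not at hc
      apply hx
      have h1 := hc.1 x
      have h2 := hc.2 x
      split_ifs with h3 h4 h4 <;> simp_all
    intro q q' hq hq'
    rcases key q hq with ⟨x, rfl, hx⟩ | ⟨x, rfl, hx⟩ <;>
      rcases key q' hq' with ⟨y, rfl, hy⟩ | ⟨y, rfl, hy⟩
    · exact (hll x y hx hy).imp (fun h => hφ h) (fun h => hφ h)
    · exact Or.inl ((hle x).trans (hψ (hlr x y hx hy)))
    · exact Or.inr ((hle y).trans (hψ (hlr y x hy hx)))
    · exact (hrr x y hx hy).imp (fun h => hψ h) (fun h => hψ h)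
  · unfold mixOC
    rw [Finset.sum_comm, ← hsum]
    refine Finset.sum_congr rfl fun x _ => ?_
    rw [Finset.sum_add_distrib]
    simp

theorem mixOC_continuous {X : Type*} [TopologicalSpace X] (φ ψ : P → Q) {l r : X → P → ℝ}
    (hl : Continuous l) (hr : Continuous r) : Continuous fun t => mixOC φ ψ (l t) (r t) := by
  refine continuous_pi fun q => continuous_finsetSum _ fun x _ => Continuous.add ?_ ?_
  · by_cases h : φ x = q
    · simp only [h, if_true]; exact (continuous_apply x).comp hl
    · simp only [h, if_false]; exact continuous_const
  · by_cases h : ψ x = q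
    · simp only [h, if_true]; exact (continuous_apply x).comp hr
    · simp only [h, if_false]; exact continuous_const

/-- The map of order complexes induced by a monotone map. -/
noncomputable def pushOC (φ : P → Q) (hφ : Monotone φ) : C(OC P, OC Q) where
  toFun f := ⟨mixOC φ φ f.1 0, mixOC_mem hφ hφ (fun _ => le_rfl) f.2.1 (fun _ => le_rfl)
    (by simpa using f.2.2.2) f.2.2.1 (fun x y h => absurd rfl h) (fun x y _ h => absurd rfl h)⟩
  continuous_toFun := Continuous.subtype_mk
    (mixOC_continuous φ φ continuous_subtype_val continuous_const) _

theorem pushOC_apply (φ : P → Q) (hφ : Monotone φ) (f : OC P) (q : Q) :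
    (pushOC φ hφ f).1 q = ∑ x, if φ x = q then f.1 x else 0 := by
  simp [pushOC, mixOC]

theorem pushOC_id : pushOC (id : P → P) monotone_id = ContinuousMap.id _ := by
  ext f q
  rw [pushOC_apply]
  simp

theorem pushOC_comp (φ : P → Q) (hφ : Monotone φ) (ψ : Q → R) (hψ : Monotone ψ) :
    (pushOC ψ hψ).comp (pushOC φ hφ) = pushOC (ψ ∘ φ) (hψ.comp hφ) := by
  ext f q
  rw [ContinuousMap.comp_apply, pushOC_apply, pushOC_apply]
  simp only [pushOC_apply]
  have : ∀ x, (if ψ x = q then ∑ y, (if φ y = x then f.1 y else 0) else 0)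
      = ∑ y, if φ y = x then (if ψ x = q then f.1 y else 0) else 0 := by
    intro x
    split_ifs with h
    · rfl
    · simp
  simp only [this]
  rw [Finset.sum_comm]
  simp

/-- Mass strictly below `x`. -/
noncomputable def lowOC (f : P → ℝ) (x : P) : ℝ := ∑ y, if y < x then f y else 0

theorem lowOC_continuous : Continuous fun f : P → ℝ => lowOC f := by
  refine continuous_pi fun x => continuous_finsetSum _ fun y _ => ?_
  by_cases h : y < x
  · simp only [h, if_true]; exact continuous_apply y
  · simp only [h, if_false]; exact continuous_const

theorem lowOC_nonneg {f : P → ℝ} (hf : f ∈ OC P) (x : P) : 0 ≤ lowOC f x :=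
  Finset.sum_nonneg fun y _ => by split_ifs <;> simp [hf.1]

theorem lowOC_add_le {f : P → ℝ} (hf : f ∈ OC P) (x : P) : lowOC f x + f x ≤ 1 := by
  have h : f x = ∑ y, if y = x then f y else 0 := by simp
  rw [← hf.2.2, h, lowOC, ← Finset.sum_add_distrib]
  refine Finset.sum_le_sum fun y _ => ?_
  have := hf.1 y
  by_cases h1 : y < x
  · simp [h1, h1.ne]
  · by_cases h2 : y = x
    · simp [h2]
    · simp [h1, h2, this]

theorem lowOC_mono {f : P → ℝ} (hf : f ∈ OC P) {x y : P} (hxy : x < y) :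
    lowOC f x + f x ≤ lowOC f y := by
  have h : f x = ∑ y, if y = x then f y else 0 := by simp
  rw [h, lowOC, lowOC, ← Finset.sum_add_distrib]
  refine Finset.sum_le_sum fun z _ => ?_
  have := hf.1 z
  by_cases h1 : z < x
  · simp [h1, h1.ne, h1.trans hxy]
  · by_cases h2 : z = x
    · subst h2; simp [hxy]
    · simp only [h1, h2, if_false, add_zero]
      split_ifs <;> simp [this]

/-- Comparable monotone maps induce homotopic maps of order complexes. -/
theorem pushOC_homotopic {φ ψ : P → Q} (hφ : Monotone φ) (hψ : Monotone ψ)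
    (hle : ∀ x, φ x ≤ ψ x) : (pushOC φ hφ).Homotopic (pushOC ψ hψ) := by
  let ℓ : ℝ → (P → ℝ) → P → ℝ := fun t f x => min t (lowOC f x + f x) - min t (lowOC f x)
  have hℓ0 : ∀ t f, f ∈ OC P → ∀ x, 0 ≤ ℓ t f x := fun t f hf x =>
    sub_nonneg.2 (min_le_min le_rfl (by have := hf.1 x; linarith))
  have hℓ1 : ∀ t f, f ∈ OC P → ∀ x, ℓ t f x ≤ f x := fun t f hf x => by
    have := hf.1 x
    simp only [ℓ]
    rcases le_total t (lowOC f x) with h | h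
    · rw [min_eq_left h, min_eq_left (by linarith)]; linarith
    · rw [min_eq_right h]
      have := min_le_right t (lowOC f x + f x)
      linarith
  have hcont : Continuous fun p : unitInterval × OC P => ℓ (1 - p.1.1) p.2.1 := by
    refine continuous_pi fun x => ?_
    have h1 : Continuous fun p : unitInterval × OC P => lowOC p.2.1 x :=
      (continuous_apply x).comp (lowOC_continuous.comp (continuous_subtype_val.comp continuous_snd))
    have h2 : Continuous fun p : unitInterval × OC P => p.2.1 x :=
      (continuous_apply x).comp (continuous_subtype_val.comp continuous_snd)
    have h3 : Continuous fun p : unitInterval × OC P => (1 : ℝ) - p.1.1 :=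
      continuous_const.sub (continuous_subtype_val.comp continuous_fst)
    exact (h3.min (h1.add h2)).sub (h3.min h1)
  have hcont2 : Continuous fun p : unitInterval × OC P => p.2.1 - ℓ (1 - p.1.1) p.2.1 :=
    (continuous_subtype_val.comp continuous_snd).sub hcont
  have hmem : ∀ p : unitInterval × OC P,
      mixOC φ ψ (ℓ (1 - p.1.1) p.2.1) (p.2.1 - ℓ (1 - p.1.1) p.2.1) ∈ OC Q := by
    rintro ⟨t, f, hf⟩
    have hne : ∀ x, ℓ (1 - t.1) f x ≠ 0 → f x ≠ 0 := fun x hx h => by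
      have h1 := hℓ0 (1 - t.1) f hf x
      have h2 := hℓ1 (1 - t.1) f hf x
      exact hx (le_antisymm (h ▸ h2) h1)
    have hne2 : ∀ x, (f - ℓ (1 - t.1) f) x ≠ 0 → f x ≠ 0 := fun x hx h => by
      have h1 := hℓ0 (1 - t.1) f hf x
      have h2 := hℓ1 (1 - t.1) f hf x
      apply hx
      simp only [Pi.sub_apply]
      linarith
    refine mixOC_mem hφ hψ hle (hℓ0 _ f hf) (fun x => sub_nonneg.2 (hℓ1 _ f hf x)) ?_ ?_ ?_ ?_
    · simpa using hf.2.2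
    · exact fun x y hx hy => hf.2.1 x y (hne x hx) (hne y hy)
    · exact fun x y hx hy => hf.2.1 x y (hne2 x hx) (hne2 y hy)
    · intro x y hx hy
      rcases hf.2.1 x y (hne x hx) (hne2 y hy) with h | h
      · exact h
      · rcases h.eq_or_lt with h | h
        · exact h.ge
        · exfalso
          have h1 := lowOC_mono hf h
          have h2 := hf.1 x
          have h3 := hf.1 y
          rcases le_total (1 - t.1) (lowOC f x) with h4 | h4
          · apply hx
            simp only [ℓ]
            rw [min_eq_left h4, min_eq_left (by linarith)]
            ring
          · apply hy
            simp only [Pi.sub_apply, ℓ]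
            rw [min_eq_right (by linarith), min_eq_right (by linarith)]
            ring
  refine ⟨⟨⟨fun p => ⟨_, hmem p⟩, Continuous.subtype_mk (mixOC_continuous φ ψ hcont hcont2) _⟩,
    ?_, ?_⟩⟩
  · rintro ⟨f, hf⟩
    ext q
    rw [pushOC_apply]
    have h : ℓ 1 f = f := by
      funext x
      have h1 := lowOC_add_le hf x
      have h2 := hf.1 x
      simp only [ℓ]
      rw [min_eq_right h1, min_eq_right (by linarith)]
      ring
    simp [mixOC, h]
  · rintro ⟨f, hf⟩
    ext q
    rw [pushOC_apply]
    have h : ℓ 0 f = 0 := by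
      funext x
      have h1 := lowOC_nonneg hf x
      have h2 := hf.1 x
      simp only [ℓ]
      rw [min_eq_left h1, min_eq_left (by linarith)]
      simp
    simp [mixOC, h]

/-- A poset which is conically contractible has contractible order complex. -/
theorem OC_contractible (f : P → P) (hf : Monotone f) (j : P) (h1 : ∀ x, f x ≤ x)
    (h2 : ∀ x, f x ≤ j) : ContractibleSpace (OC P) := by
  rw [contractible_iff_id_nullhomotopic]
  have h3 := pushOC_homotopic hf monotone_id h1
  have h4 := pushOC_homotopic hf (monotone_const (c := j)) h2
  rw [pushOC_id] at h3
  have hj : Pi.single j 1 ∈ OC P := by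
    refine ⟨fun x => ?_, ?_, by simp⟩
    · by_cases h : x = j
      · subst h; simp
      · simp [h]
    · intro x y hx hy
      have : ∀ x, (Pi.single j (1 : ℝ) : P → ℝ) x ≠ 0 → x = j := fun x hx => by
        by_contra h; exact hx (by simp [h])
      rw [this x hx, this y hy]
      exact Or.inl le_rfl
  refine ⟨⟨_, hj⟩, ?_⟩
  have h5 : pushOC (fun _ : P => j) monotone_const = ContinuousMap.const _ ⟨_, hj⟩ := by
    ext g x
    rw [pushOC_apply]
    by_cases h : x = j
    · subst h; simpa using g.2.2.2
    · simp [h, Ne.symm h]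
  rw [h5] at h4
  exact h3.symm.trans h4

/-- A retraction with `g ∘ f ≤ id` gives a homotopy equivalence of order complexes. -/
theorem OC_hequiv (f : P → Q) (hf : Monotone f) (g : Q → P) (hg : Monotone g)
    (hfg : ∀ q, f (g q) = q) (hgf : ∀ p, g (f p) ≤ p) :
    Nonempty (ContinuousMap.HomotopyEquiv (OC P) (OC Q)) := by
  refine ⟨⟨pushOC f hf, pushOC g hg, ?_, ?_⟩⟩
  · rw [pushOC_comp, ← pushOC_id]
    exact pushOC_homotopic _ _ hgf
  · rw [pushOC_comp]
    have : f ∘ g = id := funext hfg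
    simp only [this]
    rw [pushOC_id]

end orderComplexes

/-! ### The proper part of a Boolean lattice is a sphere -/

section sphere

/-- Proper part of the Boolean lattice on `d + 1` atoms. -/
abbrev BoolQ (d : ℕ) : Type := {S : Finset (Fin (d + 1)) // S.Nonempty ∧ Sᶜ.Nonempty}

/-- The boundary of the cube between minimum `0` and maximum `1`. -/
def BdX (d : ℕ) : Set (Fin (d + 1) → ℝ) :=
  {x | (∀ i, 0 ≤ x i) ∧ (∀ i, x i ≤ 1) ∧ (∃ i, x i = 0) ∧ ∃ i, x i = 1}

/-- Sum of indicator vectors. -/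
noncomputable def phiQ {d : ℕ} (f : BoolQ d → ℝ) (i : Fin (d + 1)) : ℝ :=
  ∑ S : BoolQ d, if i ∈ S.1 then f S else 0

/-- Layer decomposition. -/
noncomputable def psiQ {d : ℕ} (x : Fin (d + 1) → ℝ) (S : BoolQ d) : ℝ :=
  max (S.1.inf' S.2.1 x - S.1ᶜ.sup' S.2.2 x) 0

variable {d : ℕ}

theorem phiQ_continuous : Continuous (phiQ (d := d)) := by
  refine continuous_pi fun i => continuous_finsetSum _ fun S _ => ?_
  by_cases h : i ∈ S.1
  · simp only [h, if_true]; exact continuous_apply S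
  · simp only [h, if_false]; exact continuous_const

theorem psiQ_continuous : Continuous (psiQ (d := d)) := by
  refine continuous_pi fun S => Continuous.max (Continuous.sub ?_ ?_) continuous_const
  · exact Continuous.finset_inf'_apply S.2.1 (fun i _ => continuous_apply i)
  · exact Continuous.finset_sup'_apply S.2.2 (fun i _ => continuous_apply i)

/-- The level set of the layer decomposition. -/
def layQ (x : Fin (d + 1) → ℝ) (S : BoolQ d) : Set ℝ := {t | ∀ i, t < x i ↔ i ∈ S.1}

theorem layQ_eq (x : Fin (d + 1) → ℝ) (S : BoolQ d) :
    layQ x S = Set.Ico (S.1ᶜ.sup' S.2.2 x) (S.1.inf' S.2.1 x) := by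
  ext t
  simp only [layQ, Set.mem_ofPred_eq, Set.mem_Ico, Finset.lt_inf'_iff, Finset.sup'_le_iff,
    Finset.mem_compl]
  constructor
  · intro h
    exact ⟨fun i hi => not_lt.1 fun hc => hi ((h i).1 hc), fun i hi => (h i).2 hi⟩
  · rintro ⟨h1, h2⟩ i
    exact ⟨fun h => by by_contra hc; exact absurd (h1 i hc) (not_le.2 h), h2 i⟩

theorem psiQ_eq (x : Fin (d + 1) → ℝ) (S : BoolQ d) :
    psiQ x S = MeasureTheory.volume.real (layQ x S) := by
  rw [layQ_eq, Real.volume_real_Ico, psiQ]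

theorem psiQ_sum (x : Fin (d + 1) → ℝ) (F : Finset (BoolQ d)) :
    ∑ S ∈ F, psiQ x S = MeasureTheory.volume.real (⋃ S ∈ F, layQ x S) := by
  simp only [psiQ_eq]
  refine (MeasureTheory.measureReal_biUnion_finset ?_ ?_ ?_).symm
  · intro S _ S' _ hne
    rw [Function.onFun, Set.disjoint_left]
    intro t h1 h2
    apply hne
    apply Subtype.ext
    ext i
    exact (h1 i).symm.trans (h2 i)
  · intro S _
    rw [layQ_eq]
    exact measurableSet_Ico
  · intro S _
    rw [layQ_eq, Real.volume_Ico]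
    exact ENNReal.ofReal_ne_top

/-- The superlevel set, as an element of the Boolean lattice. -/
theorem exists_layQ {x : Fin (d + 1) → ℝ} (hx : x ∈ BdX d) {t : ℝ} (h0 : 0 ≤ t) (h1 : t < 1) :
    ∃ S : BoolQ d, t ∈ layQ x S := by
  obtain ⟨-, -, ⟨i, hi⟩, ⟨k, hk⟩⟩ := hx
  refine ⟨⟨Finset.univ.filter fun i => t < x i, ⟨k, by simp [hk, h1]⟩, ⟨i, by simp [hi, h0]⟩⟩, ?_⟩
  intro l
  simp

theorem layQ_nonneg {x : Fin (d + 1) → ℝ} (hx : x ∈ BdX d) {t : ℝ} {S : BoolQ d}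
    (h : t ∈ layQ x S) : 0 ≤ t ∧ t < 1 := by
  obtain ⟨i, hi⟩ := S.2.1
  obtain ⟨k, hk⟩ := S.2.2
  have h1 := (h i).2 hi
  have h2 : ¬ t < x k := fun hc => (Finset.mem_compl.1 hk) ((h k).1 hc)
  have h3 := hx.1 k
  have h4 := hx.2.1 i
  constructor <;> linarith

theorem psiQ_mem {x : Fin (d + 1) → ℝ} (hx : x ∈ BdX d) : psiQ x ∈ OC (BoolQ d) := by
  refine ⟨fun S => le_max_right _ _, ?_, ?_⟩
  · intro S S' hS hS'
    have key : ∀ S : BoolQ d, psiQ x S ≠ 0 → ∃ t, t ∈ layQ x S := by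
      intro S hS
      by_contra hc
      push Not at hc
      apply hS
      rw [psiQ_eq, Set.eq_empty_iff_forall_notMem.2 hc]
      simp
    obtain ⟨t, ht⟩ := key S hS
    obtain ⟨t', ht'⟩ := key S' hS'
    rcases le_total t t' with h | h
    · right
      exact fun i hi => (ht i).1 (h.trans_lt ((ht' i).2 hi))
    · left
      exact fun i hi => (ht' i).1 (h.trans_lt ((ht i).2 hi))
  · rw [psiQ_sum]
    have : (⋃ S ∈ (Finset.univ : Finset (BoolQ d)), layQ x S) = Set.Ico 0 1 := by
      ext t
      simp only [Finset.mem_univ, Set.iUnion_true, Set.mem_iUnion, Set.mem_Ico]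
      exact ⟨fun ⟨S, hS⟩ => layQ_nonneg hx hS, fun h => exists_layQ hx h.1 h.2⟩
    rw [this, Real.volume_real_Ico]
    simp

theorem phiQ_psiQ {x : Fin (d + 1) → ℝ} (hx : x ∈ BdX d) : phiQ (psiQ x) = x := by
  funext i
  unfold phiQ
  rw [← Finset.sum_filter, psiQ_sum]
  have : (⋃ S ∈ (Finset.univ : Finset (BoolQ d)).filter (fun S => i ∈ S.1), layQ x S)
      = Set.Ico 0 (x i) := by
    ext t
    simp only [Finset.mem_filter, Finset.mem_univ, true_and, Set.mem_iUnion, Set.mem_Ico,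
      exists_prop]
    constructor
    · rintro ⟨S, hi, hS⟩
      exact ⟨(layQ_nonneg hx hS).1, (hS i).2 hi⟩
    · rintro ⟨h1, h2⟩
      obtain ⟨S, hS⟩ := exists_layQ hx h1 (h2.trans_le (hx.2.1 i))
      exact ⟨S, (hS i).1 h2, hS⟩
  rw [this, Real.volume_real_Ico]
  simp [hx.1 i]

theorem phiQ_mem {f : BoolQ d → ℝ} (hf : f ∈ OC (BoolQ d)) : phiQ f ∈ BdX d := by
  have hterm : ∀ i (S : BoolQ d), 0 ≤ (if i ∈ S.1 then f S else 0) := fun i S => by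
    split_ifs <;> simp [hf.1]
  have hne : (Finset.univ.filter fun S : BoolQ d => f S ≠ 0).Nonempty := by
    by_contra hc
    rw [Finset.not_nonempty_iff_eq_empty, Finset.filter_eq_empty_iff] at hc
    have h1 := hf.2.2
    rw [Finset.sum_eq_zero (fun S hS => not_not.1 (hc hS))] at h1
    norm_num at h1
  refine ⟨fun i => Finset.sum_nonneg fun S _ => hterm i S, fun i => ?_, ?_, ?_⟩
  · rw [← hf.2.2]
    refine Finset.sum_le_sum fun S _ => ?_
    split_ifs <;> simp [hf.1]
  · obtain ⟨S, hS⟩ := Finset.exists_maximal hne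
    have hSm := (Finset.mem_filter.1 hS.1).2
    obtain ⟨k, hk⟩ := S.2.2
    refine ⟨k, Finset.sum_eq_zero fun S' _ => ?_⟩
    split_ifs with h
    · by_contra hc
      have h2 : S' ≤ S := by
        rcases hf.2.1 S' S hc hSm with h3 | h3
        · exact h3
        · exact hS.2 (Finset.mem_filter.2 ⟨Finset.mem_univ _, hc⟩) h3
      exact (Finset.mem_compl.1 hk) (h2 h)
    · rfl
  · obtain ⟨S, hS⟩ := Finset.exists_minimal hne
    have hSm := (Finset.mem_filter.1 hS.1).2
    obtain ⟨k, hk⟩ := S.2.1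
    refine ⟨k, ?_⟩
    rw [← hf.2.2]
    refine Finset.sum_congr rfl fun S' _ => ?_
    split_ifs with h
    · rfl
    · by_contra hc
      have h2 : S ≤ S' := by
        rcases hf.2.1 S S' hSm (Ne.symm hc) with h3 | h3
        · exact h3
        · exact hS.2 (Finset.mem_filter.2 ⟨Finset.mem_univ _, Ne.symm hc⟩) h3
      exact h (h2 hk)

theorem psiQ_phiQ {f : BoolQ d → ℝ} (hf : f ∈ OC (BoolQ d)) : psiQ (phiQ f) = f := by
  have hle : ∀ S ∈ (Finset.univ : Finset (BoolQ d)), f S ≤ psiQ (phiQ f) S := by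
    intro S _
    by_cases h0 : f S = 0
    · rw [h0]; exact le_max_right _ _
    · refine le_trans ?_ (le_max_left _ _)
      obtain ⟨i, hi, hie⟩ := Finset.exists_mem_eq_inf' S.2.1 (phiQ f)
      obtain ⟨k, hk, hke⟩ := Finset.exists_mem_eq_sup' S.2.2 (phiQ f)
      rw [hie, hke, phiQ, phiQ, ← Finset.sum_sub_distrib]
      have hk' := Finset.mem_compl.1 hk
      have h1 : f S = (if i ∈ S.1 then f S else 0) - (if k ∈ S.1 then f S else 0) := by
        simp [hi, hk']
      rw [h1]
      refine Finset.single_le_sum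
        (f := fun S : BoolQ d => (if i ∈ S.1 then f S else 0) - (if k ∈ S.1 then f S else 0))
        (fun S' _ => ?_) (Finset.mem_univ S)
      have h2 := hf.1 S'
      by_cases h3 : f S' = 0
      · simp [h3]
      · rcases hf.2.1 S S' h0 h3 with h4 | h4
        · have : i ∈ S'.1 := h4 hi
          simp only [this, if_true]
          split_ifs <;> simp [h2]
        · have : k ∉ S'.1 := fun hc => hk' (h4 hc)
          simp only [this, if_false]
          split_ifs <;> simp [h2]
  have h := (Finset.sum_eq_sum_iff_of_le hle).1 (by rw [hf.2.2, (psiQ_mem (phiQ_mem hf)).2.2])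
  funext S
  exact (h S (Finset.mem_univ S)).symm

/-- The order complex of the Boolean proper part is the boundary `BdX`. -/
noncomputable def homeoQ (d : ℕ) : OC (BoolQ d) ≃ₜ BdX d where
  toFun f := ⟨phiQ f.1, phiQ_mem f.2⟩
  invFun x := ⟨psiQ x.1, psiQ_mem x.2⟩
  left_inv f := Subtype.ext (psiQ_phiQ f.2)
  right_inv x := Subtype.ext (phiQ_psiQ x.2)
  continuous_toFun := Continuous.subtype_mk (phiQ_continuous.comp continuous_subtype_val) _
  continuous_invFun := Continuous.subtype_mk (psiQ_continuous.comp continuous_subtype_val) _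

/-- Differences with the zeroth coordinate. -/
noncomputable def difX (x : Fin (d + 1) → ℝ) : EuclideanSpace ℝ (Fin d) :=
  WithLp.toLp 2 fun i => x i.succ - x 0

/-- Extension by zero. -/
noncomputable def extX (y : EuclideanSpace ℝ (Fin d)) : Fin (d + 1) → ℝ :=
  Fin.cons 0 (fun i => y i)

/-- Minimum. -/
noncomputable def minX (z : Fin (d + 1) → ℝ) : ℝ := Finset.univ.inf' Finset.univ_nonempty z

/-- Maximum. -/
noncomputable def maxX (z : Fin (d + 1) → ℝ) : ℝ := Finset.univ.sup' Finset.univ_nonempty z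

theorem minX_le (z : Fin (d + 1) → ℝ) (i) : minX z ≤ z i := Finset.inf'_le _ (Finset.mem_univ i)

theorem le_maxX (z : Fin (d + 1) → ℝ) (i) : z i ≤ maxX z := Finset.le_sup' _ (Finset.mem_univ i)

theorem exists_minX (z : Fin (d + 1) → ℝ) : ∃ i, minX z = z i := by
  obtain ⟨i, -, h⟩ := Finset.exists_mem_eq_inf' Finset.univ_nonempty z
  exact ⟨i, h⟩

theorem exists_maxX (z : Fin (d + 1) → ℝ) : ∃ i, maxX z = z i := by
  obtain ⟨i, -, h⟩ := Finset.exists_mem_eq_sup' Finset.univ_nonempty z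
  exact ⟨i, h⟩

theorem difX_ne {x : Fin (d + 1) → ℝ} (hx : x ∈ BdX d) : difX x ≠ 0 := by
  intro h
  have h1 : ∀ i, x i = x 0 := by
    intro i
    refine Fin.cases rfl (fun k => ?_) i
    have := congrArg (fun v : EuclideanSpace ℝ (Fin d) => v k) h
    simp only [difX, PiLp.zero_apply] at this
    linarith
  obtain ⟨-, -, ⟨i, hi⟩, ⟨k, hk⟩⟩ := hx
  rw [h1] at hi hk
  linarith

theorem maxX_sub_pos {y : EuclideanSpace ℝ (Fin d)} (hy : y ≠ 0) :
    0 < maxX (extX y) - minX (extX y) := by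
  by_contra hc
  apply hy
  ext k
  have h1 := minX_le (extX y) 0
  have h2 := le_maxX (extX y) 0
  have h3 := minX_le (extX y) k.succ
  have h4 := le_maxX (extX y) k.succ
  have h5 : extX y 0 = 0 := rfl
  have h6 : extX y k.succ = y k := rfl
  simp only [PiLp.zero_apply]
  linarith

/-- The normalized vector in `BdX`. -/
noncomputable def nrmX (y : EuclideanSpace ℝ (Fin d)) (i : Fin (d + 1)) : ℝ :=
  (extX y i - minX (extX y)) / (maxX (extX y) - minX (extX y))

theorem nrmX_mem {y : EuclideanSpace ℝ (Fin d)} (hy : y ≠ 0) : nrmX y ∈ BdX d := by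
  have h := maxX_sub_pos hy
  refine ⟨fun i => ?_, fun i => ?_, ?_, ?_⟩
  · exact div_nonneg (sub_nonneg.2 (minX_le _ i)) h.le
  · rw [nrmX, div_le_one h]
    have := le_maxX (extX y) i
    linarith
  · obtain ⟨i, hi⟩ := exists_minX (extX y)
    exact ⟨i, by rw [nrmX, ← hi]; simp⟩
  · obtain ⟨i, hi⟩ := exists_maxX (extX y)
    exact ⟨i, by rw [nrmX, ← hi]; exact div_self h.ne'⟩

theorem nrmX_difX {x : Fin (d + 1) → ℝ} (hx : x ∈ BdX d) {r : ℝ} (hr : 0 < r) :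
    nrmX (r • difX x) = x := by
  have hz : ∀ i, extX (r • difX x) i = r * (x i - x 0) := by
    intro i
    refine Fin.cases ?_ (fun k => ?_) i
    · simp [extX]
    · simp [extX, difX]
  obtain ⟨h1, h2, ⟨i, hi⟩, ⟨k, hk⟩⟩ := hx
  have hmin : minX (extX (r • difX x)) = r * (0 - x 0) := by
    apply le_antisymm
    · have := minX_le (extX (r • difX x)) i
      rwa [hz, hi] at this
    · obtain ⟨l, hl⟩ := exists_minX (extX (r • difX x))
      rw [hl, hz]
      have := h1 l
      gcongr
  have hmax : maxX (extX (r • difX x)) = r * (1 - x 0) := by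
    apply le_antisymm
    · obtain ⟨l, hl⟩ := exists_maxX (extX (r • difX x))
      rw [hl, hz]
      have := h2 l
      gcongr
    · have := le_maxX (extX (r • difX x)) k
      rwa [hz, hk] at this
  funext l
  rw [nrmX, hz, hmin, hmax]
  have h3 : r * (1 - x 0) - r * (0 - x 0) = r := by ring
  rw [h3]
  field_simp
  ring

theorem difX_nrmX (y : EuclideanSpace ℝ (Fin d)) :
    difX (nrmX y) = (maxX (extX y) - minX (extX y))⁻¹ • y := by
  ext k
  simp only [difX, nrmX, PiLp.smul_apply, smul_eq_mul]
  have h5 : extX y 0 = 0 := rfl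
  have h6 : extX y k.succ = y k := rfl
  rw [h5, h6]
  ring

theorem difX_continuous : Continuous (difX (d := d)) := by
  unfold difX
  fun_prop

theorem extX_continuous : Continuous (extX (d := d)) := by
  unfold extX
  refine continuous_pi fun i => ?_
  refine Fin.cases ?_ (fun k => ?_) i
  · simp only [Fin.cons_zero]; exact continuous_const
  · simp only [Fin.cons_succ]; fun_prop

theorem minX_continuous : Continuous (minX (d := d)) :=
  Continuous.finset_inf'_apply _ (fun i _ => continuous_apply i)

theorem maxX_continuous : Continuous (maxX (d := d)) :=
  Continuous.finset_sup'_apply _ (fun i _ => continuous_apply i)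

theorem sphere_ne {y : EuclideanSpace ℝ (Fin d)}
    (hy : y ∈ Metric.sphere (0 : EuclideanSpace ℝ (Fin d)) 1) : y ≠ 0 := by
  rintro rfl
  simp at hy

/-- `BdX` is a sphere. -/
noncomputable def homeoX (d : ℕ) :
    BdX d ≃ₜ Metric.sphere (0 : EuclideanSpace ℝ (Fin d)) 1 where
  toFun x := ⟨‖difX x.1‖⁻¹ • difX x.1, by
    rw [mem_sphere_zero_iff_norm, norm_smul, norm_inv, norm_norm]
    exact inv_mul_cancel₀ (norm_ne_zero_iff.2 (difX_ne x.2))⟩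
  invFun y := ⟨nrmX y.1, nrmX_mem (sphere_ne y.2)⟩
  left_inv x := Subtype.ext (nrmX_difX x.2 (inv_pos.2 (norm_pos_iff.2 (difX_ne x.2))))
  right_inv y := by
    apply Subtype.ext
    have h := maxX_sub_pos (sphere_ne y.2)
    have h1 : ‖y.1‖ = 1 := mem_sphere_zero_iff_norm.1 y.2
    simp only [difX_nrmX]
    rw [norm_smul, h1, mul_one, norm_inv, Real.norm_of_nonneg h.le, inv_inv, smul_smul,
      mul_inv_cancel₀ h.ne', one_smul]
  continuous_toFun := by
    have h := difX_continuous.comp (continuous_subtype_val (p := fun x => x ∈ BdX d))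
    refine Continuous.subtype_mk (Continuous.smul (Continuous.inv₀ h.norm ?_) h) _
    exact fun x => norm_ne_zero_iff.2 (difX_ne x.2)
  continuous_invFun := by
    have h := extX_continuous.comp (continuous_subtype_val
      (p := fun y => y ∈ Metric.sphere (0 : EuclideanSpace ℝ (Fin d)) 1))
    have hm := minX_continuous.comp h
    have hM := maxX_continuous.comp h
    refine Continuous.subtype_mk (continuous_pi fun i => ?_) _
    refine Continuous.div (((continuous_apply i).comp h).sub hm) (hM.sub hm) ?_
    exact fun y => (maxX_sub_pos (sphere_ne y.2)).ne'

end sphere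

/-! ### Intervals whose joins of atoms behave like a Boolean lattice -/

section crosscut

/-- Two empty spaces are homotopy equivalent. -/
theorem hequiv_of_empty (X Y : Type*) [TopologicalSpace X] [TopologicalSpace Y] [IsEmpty X]
    [IsEmpty Y] : Nonempty (ContinuousMap.HomotopyEquiv X Y) :=
  ⟨(Homeomorph.empty : X ≃ₜ Y).toHomotopyEquiv⟩

variable {P : Type*} [Fintype P] [PartialOrder P] (u : P) (A : Finset ℕ)
  (atm : P → Finset ℕ) (J : Finset ℕ → P)

/-- The data of the atoms above `u`, together with the joins of sets of atoms. -/
structure AtomData : Prop where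
  mono : ∀ x y, x ≤ y → atm x ⊆ atm y
  sub : ∀ x, atm x ⊆ A
  ne : ∀ x, u < x → (atm x).Nonempty
  le : ∀ S, S ⊆ A → u ≤ J S
  join : ∀ S, S ⊆ A → ∀ x, u ≤ x → S ⊆ atm x → J S ≤ x
  atom : ∀ S, S ⊆ A → atm (J S) = S

variable {u A atm J}

theorem AtomData.bot (h : AtomData u A atm J) : J ∅ = u :=
  le_antisymm (h.join ∅ (by simp) u le_rfl (by simp)) (h.le ∅ (by simp))

theorem AtomData.atm_bot (h : AtomData u A atm J) : atm u = ∅ := by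
  conv_lhs => rw [← h.bot]
  exact h.atom ∅ (by simp)

theorem AtomData.lt_join (h : AtomData u A atm J) {S : Finset ℕ} (hS : S ⊆ A)
    (hn : S.Nonempty) : u < J S := by
  refine lt_of_le_of_ne (h.le S hS) fun he => ?_
  have h1 := h.atom S hS
  rw [← he, h.atm_bot] at h1
  rw [← h1] at hn
  exact Finset.not_nonempty_empty hn

theorem AtomData.topology (h : AtomData u A atm J) (z : P) (hz : u ≤ z) :
    (∃ d : ℕ, Nonempty (ContinuousMap.HomotopyEquiv
          ↥(OC {x : P // u < x ∧ x < z})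
          ↥(Metric.closedBall (0 : EuclideanSpace ℝ (Fin d)) 1))) ∨
       (∃ d : ℕ, Nonempty (ContinuousMap.HomotopyEquiv
          ↥(OC {x : P // u < x ∧ x < z})
          ↥(Metric.sphere (0 : EuclideanSpace ℝ (Fin d)) 1))) := by
  rcases hz.eq_or_lt with rfl | hz
  · right
    refine ⟨0, ?_⟩
    have hI : IsEmpty {x : P // u < x ∧ x < u} :=
      ⟨fun x => lt_irrefl _ (x.2.1.trans x.2.2)⟩
    have h1 : IsEmpty ↥(OC {x : P // u < x ∧ x < u}) := by
      refine ⟨fun f => ?_⟩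
      have := f.2.2.2
      rw [Finset.univ_eq_empty, Finset.sum_empty] at this
      norm_num at this
    have h2 : IsEmpty ↥(Metric.sphere (0 : EuclideanSpace ℝ (Fin 0)) 1) := by
      refine ⟨fun f => ?_⟩
      have := f.2
      rw [Subsingleton.elim f.1 0] at this
      simp at this
    exact hequiv_of_empty _ _
  · have hle : J (atm z) ≤ z := h.join _ (h.sub z) z hz.le (Finset.Subset.refl _)
    rcases hle.eq_or_lt with heq | hlt
    · right
      obtain ⟨d, hd⟩ : ∃ d, (atm z).card = d + 1 :=
        ⟨(atm z).card - 1, by have := (h.ne z hz).card_pos; omega⟩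
      let e := Finset.equivFinOfCardEq hd
      have himg : ∀ S : Finset (Fin (d + 1)), S.image (fun i => (e.symm i : ℕ)) ⊆ atm z := by
        intro S a ha
        obtain ⟨i, -, rfl⟩ := Finset.mem_image.1 ha
        exact (e.symm i).2
      have hmem : ∀ (S : Finset (Fin (d + 1))) i,
          (e.symm i : ℕ) ∈ S.image (fun i => (e.symm i : ℕ)) ↔ i ∈ S := by
        intro S i
        constructor
        · intro hi
          obtain ⟨k, hk, hki⟩ := Finset.mem_image.1 hi
          rwa [← e.symm.injective (Subtype.ext hki)]
        · exact fun hi => Finset.mem_image.2 ⟨i, hi, rfl⟩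
      have hA : ∀ S : Finset (Fin (d + 1)), S.image (fun i => (e.symm i : ℕ)) ⊆ A :=
        fun S => (himg S).trans (h.sub z)
      let f : {x : P // u < x ∧ x < z} → BoolQ d := fun x =>
        ⟨Finset.univ.filter fun i => (e.symm i : ℕ) ∈ atm x.1, by
          obtain ⟨a, ha⟩ := h.ne x.1 x.2.1
          exact ⟨e ⟨a, h.mono _ _ x.2.2.le ha⟩, by simp [ha]⟩, by
          by_contra hc
          rw [Finset.not_nonempty_iff_eq_empty, Finset.compl_eq_empty_iff] at hc
          have h1 : atm z ⊆ atm x.1 := by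
            intro a ha
            have := Finset.mem_univ (e ⟨a, ha⟩)
            rw [← hc, Finset.mem_filter] at this
            simpa using this.2
          have h2 := h.join _ (h.sub z) x.1 x.2.1.le h1
          rw [heq] at h2
          exact absurd x.2.2 (not_lt_of_ge h2)⟩
      let g : BoolQ d → {x : P // u < x ∧ x < z} := fun S =>
        ⟨J (S.1.image (fun i => (e.symm i : ℕ))), h.lt_join (hA S.1) (S.2.1.image _), by
          refine lt_of_le_of_ne (h.join _ (hA S.1) z hz.le (himg S.1)) fun hc => ?_
          have h1 := h.atom _ (hA S.1)
          rw [hc] at h1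
          obtain ⟨i, hi⟩ := S.2.2
          rw [Finset.mem_compl, ← hmem, ← h1] at hi
          exact hi (e.symm i).2⟩
      have hf : Monotone f := by
        intro x y hxy i hi
        rw [Finset.mem_filter] at hi ⊢
        exact ⟨hi.1, h.mono _ _ hxy hi.2⟩
      have hg : Monotone g := by
        intro S S' hS
        refine h.join _ (hA S.1) _ (h.le _ (hA S'.1)) ?_
        rw [h.atom _ (hA S'.1)]
        exact Finset.image_subset_image hS
      have hfg : ∀ S, f (g S) = S := by
        intro S
        apply Subtype.ext
        ext i
        change i ∈ Finset.univ.filter _ ↔ _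
        rw [Finset.mem_filter]
        change _ ∧ (e.symm i : ℕ) ∈ atm (J _) ↔ _
        rw [h.atom _ (hA S.1), hmem]
        simp
      have hgf : ∀ x, g (f x) ≤ x := by
        intro x
        refine h.join _ (hA _) _ x.2.1.le ?_
        intro a ha
        obtain ⟨i, hi, rfl⟩ := Finset.mem_image.1 ha
        exact (Finset.mem_filter.1 hi).2
      obtain ⟨E⟩ := OC_hequiv f hf g hg hfg hgf
      exact ⟨d, ⟨E.trans ((homeoQ d).trans (homeoX d)).toHomotopyEquiv⟩⟩
    · left
      refine ⟨0, ?_⟩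
      have hc : ContractibleSpace ↥(OC {x : P // u < x ∧ x < z}) := by
        refine OC_contractible (P := {x : P // u < x ∧ x < z}) (fun x => ⟨J (atm x.1),
          h.lt_join (h.sub _) (h.ne _ x.2.1),
          lt_of_le_of_lt (h.join _ (h.sub _) x.1 x.2.1.le (Finset.Subset.refl _)) x.2.2⟩) ?_
          ⟨J (atm z), h.lt_join (h.sub _) (h.ne _ hz), hlt⟩ ?_ ?_
        · intro x y hxy
          refine h.join _ (h.sub _) _ (h.le _ (h.sub _)) ?_
          rw [h.atom _ (h.sub _)]
          exact h.mono _ _ hxy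
        · intro x
          exact h.join _ (h.sub _) x.1 x.2.1.le (Finset.Subset.refl _)
        · intro x
          refine h.join _ (h.sub _) _ (h.le _ (h.sub _)) ?_
          rw [h.atom _ (h.sub _)]
          exact h.mono _ _ x.2.2.le
      have hb : ContractibleSpace ↥(Metric.closedBall (0 : EuclideanSpace ℝ (Fin 0)) 1) :=
        (convex_closedBall _ _).contractibleSpace ⟨0, by simp⟩
      exact ContractibleSpace.hequiv _ _

theorem AtomData.moebius (h : AtomData u A atm J) (ν : P → ℤ) (h1 : ν u = 1)
    (h2 : ∀ v, u < v → ∑ w ∈ Finset.univ.filter (fun w => u ≤ w ∧ w ≤ v), ν w = 0)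
    (v : P) (hv : u ≤ v) :
    ν v = if J (atm v) = v then (-1) ^ (atm v).card else 0 := by
  induction v using WellFoundedLT.induction with
  | ind v ih =>
    rcases hv.eq_or_lt with rfl | hlt
    · simp [h.atm_bot, h.bot, h1]
    · have key : ∑ w ∈ Finset.univ.filter (fun w => u ≤ w ∧ w ≤ v),
          (if J (atm w) = w then (-1 : ℤ) ^ (atm w).card else 0) = 0 := by
        rw [← Finset.sum_filter]
        rw [← Finset.sum_powerset_neg_one_pow_card_of_nonempty (h.ne v hlt)]
        refine Finset.sum_bij' (fun w _ => atm w) (fun S _ => J S) ?_ ?_ ?_ ?_ ?_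
        · intro w hw
          simp only [Finset.mem_filter, Finset.mem_univ, true_and] at hw
          exact Finset.mem_powerset.2 (h.mono _ _ hw.1.2)
        · intro S hS
          have hS' := Finset.mem_powerset.1 hS
          have hSA := hS'.trans (h.sub v)
          simp only [Finset.mem_filter, Finset.mem_univ, true_and]
          exact ⟨⟨h.le S hSA, h.join S hSA v hv hS'⟩, by rw [h.atom S hSA]⟩
        · intro w hw
          exact (Finset.mem_filter.1 hw).2
        · intro S hS
          exact h.atom S ((Finset.mem_powerset.1 hS).trans (h.sub v))
        · intro w _
          rfl
      have hvm : v ∈ Finset.univ.filter (fun w => u ≤ w ∧ w ≤ v) := by simp [hv]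
      have h3 := h2 v hlt
      rw [← Finset.add_sum_erase _ _ hvm] at h3 key
      have h4 : ∑ w ∈ (Finset.univ.filter (fun w => u ≤ w ∧ w ≤ v)).erase v, ν w =
          ∑ w ∈ (Finset.univ.filter (fun w => u ≤ w ∧ w ≤ v)).erase v,
          (if J (atm w) = w then (-1 : ℤ) ^ (atm w).card else 0) := by
        refine Finset.sum_congr rfl fun w hw => ?_
        rw [Finset.mem_erase, Finset.mem_filter] at hw
        exact ih w (lt_of_le_of_ne hw.2.2.2 hw.1) hw.2.2.1
      rw [h4] at h3
      linarith

theorem AtomData.moebius_mem (h : AtomData u A atm J) (ν : P → ℤ) (h1 : ν u = 1)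
    (h2 : ∀ v, u < v → ∑ w ∈ Finset.univ.filter (fun w => u ≤ w ∧ w ≤ v), ν w = 0)
    (v : P) (hv : u ≤ v) : ν v = -1 ∨ ν v = 0 ∨ ν v = 1 := by
  rw [h.moebius ν h1 h2 v hv]
  split_ifs
  · rcases neg_one_pow_eq_or ℤ (atm v).card with h | h <;> simp [h]
  · simp

end crosscut

/-! ### Intervals of the `s`-Tamari lattice -/

namespace SDecTree

variable {n : ℕ} {s : ℕ → ℕ}

theorem parent_le_n (T : SDecTree n s) (v : ℕ) : T.parent v < n + 1 := by
  by_cases h : v = 0 ∨ n ≤ v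
  · rw [T.parent_out v h]; omega
  · have := T.parent_le v (by omega) (by omega); omega

theorem idx_le_sup (T : SDecTree n s) (v : ℕ) :
    T.idx v < (Finset.range (n + 1)).sup s + 1 := by
  by_cases h : v = 0 ∨ n ≤ v
  · rw [T.idx_out v h]; omega
  · have h1 := T.idx_le v (by omega) (by omega)
    have h2 : s (T.parent v) ≤ (Finset.range (n + 1)).sup s :=
      Finset.le_sup (f := s) (Finset.mem_range.2 (T.parent_le_n v))
    omega

theorem ext' {T Z : SDecTree n s} (h1 : T.parent = Z.parent) (h2 : T.idx = Z.idx) : T = Z := by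
  cases T; cases Z; cases h1; cases h2; rfl

instance finite_sDecTree : Finite (SDecTree n s) := by
  let F : SDecTree n s → (Fin n → Fin (n + 1)) × (Fin n → Fin ((Finset.range (n + 1)).sup s + 1)) :=
    fun T => (fun v => ⟨T.parent v, T.parent_le_n v⟩, fun v => ⟨T.idx v, T.idx_le_sup v⟩)
  refine Finite.of_injective F fun T Z h => ?_
  have h1 := congrArg Prod.fst h
  have h2 := congrArg Prod.snd h
  apply ext'
  · funext v
    by_cases hv : v < n
    · exact congrArg Fin.val (congrFun h1 ⟨v, hv⟩)
    · rw [T.parent_out v (by omega), Z.parent_out v (by omega)]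
  · funext v
    by_cases hv : v < n
    · exact congrArg Fin.val (congrFun h2 ⟨v, hv⟩)
    · rw [T.idx_out v (by omega), Z.idx_out v (by omega)]

/-- The type of `s`-Tamari trees. -/
def TamTree (n : ℕ) (s : ℕ → ℕ) : Type := {T : SDecTree n s // T.IsTamari}

instance : Finite (TamTree n s) := inferInstanceAs (Finite {T : SDecTree n s // T.IsTamari})

noncomputable instance : Fintype (TamTree n s) := Fintype.ofFinite _

instance : PartialOrder (TamTree n s) where
  le T Z := wle T.1 Z.1
  lt T Z := wlt T.1 Z.1
  le_refl T := wle_refl' T.1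
  le_trans _ _ _ h1 h2 := wle_trans' h1 h2
  lt_iff_le_not_ge _ _ := Iff.rfl
  le_antisymm T Z h1 h2 :=
    Subtype.ext (tamari_ext T.2 Z.2 fun y x => le_antisymm (h1 y x) (h2 y x))

theorem tam_le_iff {T Z : TamTree n s} : T ≤ Z ↔ wle T.1 Z.1 := Iff.rfl

theorem tam_lt_iff {T Z : TamTree n s} : T < Z ↔ wlt T.1 Z.1 := Iff.rfl

/-- The lower elements of the Tamari tree ascents of `T`. -/
noncomputable def ascSet (T : TamTree n s) : Finset ℕ :=
  (Finset.range n).filter fun a => T.1.TamariAscent a (T.1.parent a)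

/-- The ascents of `T` whose rotation lies below `X`. -/
noncomputable def ascBelow (T X : TamTree n s) : Finset ℕ :=
  (ascSet T).filter fun a => T.1.card (T.1.parent a) a + 1 ≤ X.1.card (T.1.parent a) a

theorem mem_ascSet {T : TamTree n s} {a : ℕ} :
    a ∈ ascSet T ↔ T.1.TamariAscent a (T.1.parent a) := by
  unfold ascSet
  rw [Finset.mem_filter, Finset.mem_range]
  exact ⟨fun h => h.2, fun h => ⟨h.2.1, h⟩⟩

theorem ascBelow_nonempty (lab : SDecTree n s → SDecTree n s → ℕ)
    (hlab : ∀ T Z : SDecTree n s, tamcov T Z →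
      ∃ b, T.TamariAscent (lab T Z) b ∧ IsTamRotation T Z (lab T Z) b)
    {T X : TamTree n s} (h : T < X) : (ascBelow T X).Nonempty := by
  obtain ⟨Y, hY, hYX⟩ := exists_covBy_le_of_lt h
  have hc : tamcov T.1 Y.1 := by
    refine ⟨T.2, Y.2, hY.1, fun U hU h1 h2 => ?_⟩
    exact hY.2 (c := (⟨U, hU⟩ : TamTree n s)) h1 h2
  obtain ⟨b, hb, hr⟩ := hlab _ _ hc
  obtain rfl := hb.2.2.1
  refine ⟨lab T.1 Y.1, Finset.mem_filter.2 ⟨mem_ascSet.2 hb, ?_⟩⟩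
  exact (tamrot_le T.2 hr).trans (hYX _ _)

theorem exists_ascJoin (T : TamTree n s) (S : Finset ℕ) (hS : S ⊆ ascSet T) :
    ∃ X : TamTree n s, T ≤ X ∧ ascBelow T X = S ∧
      ∀ Y : TamTree n s, T ≤ Y → S ⊆ ascBelow T Y → X ≤ Y := by
  have hg := card_good T.2
  obtain ⟨I, hI, hlow, hgr⟩ := inf_good (n := n) (s := s)
    (fun K => GoodInv n s K ∧ (∀ y x, T.1.card y x ≤ K y x) ∧
      ∀ a ∈ S, T.1.card (T.1.parent a) a + 1 ≤ K (T.1.parent a) a)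
    (fun K h => h.1) ⟨_, top_good, fun y x => by
      split_ifs with h
      · exact hg.le y x
      · exact (hg.out y x h).le, fun a ha => by
      have h := mem_ascSet.1 (hS ha)
      have hp := h.par T.2
      rw [if_pos ⟨h.1, hp.lt, hp.le⟩]
      exact h.2.2.2⟩
  obtain ⟨X, hX, rfl⟩ := exists_tree hI
  refine ⟨⟨X, hX⟩, ?_, ?_, ?_⟩
  · exact fun y x => hgr _ (fun K hK => hK.2.1) y x
  · ext a
    constructor
    · intro ha
      obtain ⟨ha, hb⟩ := Finset.mem_filter.1 ha
      by_contra hc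
      have h := mem_ascSet.1 ha
      have hp := h.par T.2
      have h1 := hlow (capInv n s a (T.1.parent a) (T.1.card (T.1.parent a) a))
        ⟨cap_good h.2.2.2.le, fun y x => le_cap hg hp, fun c hc' => by
          have h' := mem_ascSet.1 (hS hc')
          exact cap_rot hg h'.1 (h'.par T.2) h'.2.2.2 hp (fun he => hc (he ▸ hc'))⟩
        (T.1.parent a) a
      rw [cap_self h.1 hp.lt hp.le] at h1
      have h2 : T.1.card (T.1.parent a) a + 1 ≤ X.card (T.1.parent a) a := hb
      omega
    · intro ha
      refine Finset.mem_filter.2 ⟨hS ha, ?_⟩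
      have h1 := hgr (fun y x => if y = T.1.parent a ∧ x = a then
        T.1.card (T.1.parent a) a + 1 else 0) (fun K hK y x => by
          split_ifs with h
          · rw [h.1, h.2]
            exact hK.2.2 a ha
          · exact Nat.zero_le _) (T.1.parent a) a
      simpa using h1
  · intro Y hY hSY
    exact hlow Y.1.card ⟨card_good Y.2, hY, fun a ha => (Finset.mem_filter.1 (hSY ha)).2⟩

theorem exists_atomData (lab : SDecTree n s → SDecTree n s → ℕ)
    (hlab : ∀ T Z : SDecTree n s, tamcov T Z →
      ∃ b, T.TamariAscent (lab T Z) b ∧ IsTamRotation T Z (lab T Z) b)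
    (T : TamTree n s) : ∃ J, AtomData T (ascSet T) (ascBelow T) J := by
  have : Nonempty (TamTree n s) := ⟨T⟩
  choose! J hJ using exists_ascJoin T
  refine ⟨J, ?_, ?_, ?_, ?_, ?_, ?_⟩
  · intro x y h a ha
    obtain ⟨h1, h2⟩ := Finset.mem_filter.1 ha
    exact Finset.mem_filter.2 ⟨h1, h2.trans (h _ _)⟩
  · exact fun x => Finset.filter_subset _ _
  · exact fun x h => ascBelow_nonempty lab hlab h
  · exact fun S hS => (hJ S hS).1
  · exact fun S hS x hx hSx => (hJ S hS).2.2 x hx hSx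
  · exact fun S hS => (hJ S hS).2.1

theorem finsum_of_range {ι X M : Type*} [AddCommMonoid M] [Fintype ι] (i : ι → X)
    (hi : Function.Injective i) (f : X → M) (hr : Function.support f ⊆ Set.range i) :
    ∑ᶠ U, f U = ∑ x, f (i x) := by
  rw [finsum_eq_sum_of_support_subset (s := Finset.univ.image i) f (by simpa using hr)]
  exact Finset.sum_image fun x _ y _ h => hi h

/-- The order complex of an open interval, as a space of functions on the interval. -/
noncomputable def tamHomeo (T Z : TamTree n s) :
    tamOrderComplex T.1 Z.1 ≃ₜ OC {x : TamTree n s // T < x ∧ x < Z} where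
  toFun f := ⟨fun x => f.1 x.1.1, by
    obtain ⟨h0, -, hs, hc, h1⟩ := f.2
    refine ⟨fun x => h0 _, ?_, ?_⟩
    · intro x y hx hy
      by_cases hxy : x = y
      · exact Or.inl hxy.le
      · have hne : x.1.1 ≠ y.1.1 := fun h => hxy (Subtype.ext (Subtype.ext h))
        rcases hc hx hy hne with h | h
        · exact Or.inl h.1
        · exact Or.inr h.1
    · rw [← h1]
      symm
      refine finsum_of_range (fun x : {x : TamTree n s // T < x ∧ x < Z} => x.1.1)
        (fun x y h => Subtype.ext (Subtype.ext h)) f.1 fun U hU => ?_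
      have := hs hU
      exact ⟨⟨⟨U, this.1⟩, this.2⟩, rfl⟩⟩
  invFun g := ⟨fun U => if h : IsTamari U ∧ wlt T.1 U ∧ wlt U Z.1 then
      g.1 ⟨⟨U, h.1⟩, h.2⟩ else 0, by
    obtain ⟨h0, hc, h1⟩ := g.2
    have hval : ∀ (U : SDecTree n s) (h : IsTamari U ∧ wlt T.1 U ∧ wlt U Z.1),
        (if h : IsTamari U ∧ wlt T.1 U ∧ wlt U Z.1 then g.1 ⟨⟨U, h.1⟩, h.2⟩ else 0) =
          g.1 ⟨⟨U, h.1⟩, h.2⟩ := fun U h => dif_pos h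
    have hsup : (Function.support fun U => if h : IsTamari U ∧ wlt T.1 U ∧ wlt U Z.1 then
        g.1 ⟨⟨U, h.1⟩, h.2⟩ else 0) ⊆ {U | IsTamari U ∧ wlt T.1 U ∧ wlt U Z.1} := by
      intro U hU
      by_contra hc
      exact hU (dif_neg hc)
    refine ⟨fun U => ?_, Set.toFinite _, hsup, ?_, ?_⟩
    · beta_reduce
      split_ifs
      · exact h0 _
      · exact le_rfl
    · intro U hU V hV hUV
      have hU' := hsup hU
      have hV' := hsup hV
      rw [Function.mem_support, hval U hU'] at hU
      rw [Function.mem_support, hval V hV'] at hV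
      have hne : (⟨⟨U, hU'.1⟩, hU'.2⟩ : {x : TamTree n s // T < x ∧ x < Z}) ≠
          ⟨⟨V, hV'.1⟩, hV'.2⟩ := by
        intro he
        exact hUV (congrArg (fun x : {x : TamTree n s // T < x ∧ x < Z} => x.1.1) he)
      rcases hc _ _ hU hV with h | h
      · exact Or.inl (lt_of_le_of_ne h hne)
      · exact Or.inr (lt_of_le_of_ne h hne.symm)
    · rw [← h1]
      refine (finsum_of_range (fun x : {x : TamTree n s // T < x ∧ x < Z} => x.1.1)
        (fun x y h => Subtype.ext (Subtype.ext h)) _ fun U hU => ?_).trans ?_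
      · have := hsup hU
        exact ⟨⟨⟨U, this.1⟩, this.2⟩, rfl⟩
      · exact Finset.sum_congr rfl fun x _ => hval x.1.1 ⟨x.1.2, x.2⟩⟩
  left_inv f := by
    apply Subtype.ext
    funext U
    change (if h : IsTamari U ∧ wlt T.1 U ∧ wlt U Z.1 then f.1 U else 0) = f.1 U
    split_ifs with h
    · rfl
    · by_contra hc
      exact h (f.2.2.2.1 (Ne.symm hc))
  right_inv g := by
    apply Subtype.ext
    funext x
    exact dif_pos (⟨x.1.2, x.2⟩ : IsTamari x.1.1 ∧ wlt T.1 x.1.1 ∧ wlt x.1.1 Z.1)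
  continuous_toFun := by
    refine Continuous.subtype_mk (continuous_pi fun x => ?_) _
    exact (continuous_apply x.1.1).comp continuous_subtype_val
  continuous_invFun := by
    refine Continuous.subtype_mk (continuous_pi fun U => ?_) _
    split_ifs with h
    · exact (continuous_apply _).comp continuous_subtype_val
    · exact continuous_const

theorem tam_interval (lab : SDecTree n s → SDecTree n s → ℕ)
    (hlab : ∀ T Z : SDecTree n s, tamcov T Z →
      ∃ b, T.TamariAscent (lab T Z) b ∧ IsTamRotation T Z (lab T Z) b)
    (T Z : SDecTree n s) (hT : IsTamari T) (hZ : IsTamari Z) (hle : wle T Z) :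
    ((∃ d : ℕ, Nonempty (ContinuousMap.HomotopyEquiv
          ↥(tamOrderComplex T Z)
          ↥(Metric.closedBall (0 : EuclideanSpace ℝ (Fin d)) 1))) ∨
       (∃ d : ℕ, Nonempty (ContinuousMap.HomotopyEquiv
          ↥(tamOrderComplex T Z)
          ↥(Metric.sphere (0 : EuclideanSpace ℝ (Fin d)) 1)))) ∧
      (∀ μ : SDecTree n s → SDecTree n s → ℤ,
        (∀ U : SDecTree n s, IsTamari U → μ U U = 1) →
        (∀ U V : SDecTree n s, IsTamari U → IsTamari V → wlt U V →
          (∑ᶠ W ∈ {W : SDecTree n s | IsTamari W ∧ wle U W ∧ wle W V}, μ U W) = 0) →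
        μ T Z = -1 ∨ μ T Z = 0 ∨ μ T Z = 1) := by
  obtain ⟨J, hJ⟩ := exists_atomData lab hlab ⟨T, hT⟩
  refine ⟨?_, ?_⟩
  · have E := (tamHomeo ⟨T, hT⟩ ⟨Z, hZ⟩).toHomotopyEquiv
    rcases hJ.topology ⟨Z, hZ⟩ hle with ⟨d, ⟨F⟩⟩ | ⟨d, ⟨F⟩⟩
    · exact Or.inl ⟨d, ⟨E.trans F⟩⟩
    · exact Or.inr ⟨d, ⟨E.trans F⟩⟩
  · intro μ h1 h2
    refine hJ.moebius_mem (fun W => μ T W.1) (h1 T hT) (fun V hV => ?_) ⟨Z, hZ⟩ hle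
    rw [← h2 T V.1 hT V.2 hV, finsum_mem_def,
      finsum_of_range (fun W : TamTree n s => W.1) (fun x y h => Subtype.ext h)]
    · rw [Finset.sum_filter]
      refine Finset.sum_congr rfl fun W _ => ?_
      by_cases h : wle T W.1 ∧ wle W.1 V.1
      · rw [Set.indicator_of_mem (show W.1 ∈ {W : SDecTree n s |
          IsTamari W ∧ wle T W ∧ wle W V.1} from ⟨W.2, h⟩)]
        exact if_pos h
      · rw [Set.indicator_of_notMem (fun hc : W.1 ∈ {W : SDecTree n s |
          IsTamari W ∧ wle T W ∧ wle W V.1} => h hc.2)]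
        exact if_neg h
    · intro W hW
      have := Set.support_indicator_subset hW
      exact ⟨⟨W, this.1⟩, rfl⟩

end SDecTree

/-- the labeling of cover relations of the `s`-Tamari lattice by the
smaller element of the associated Tamari tree ascent is an SB-labeling; consequently
every open interval of the `s`-Tamari lattice has order complex homotopy equivalent to a
ball or a sphere of some dimension, and the Möbius function of the `s`-Tamari lattice
takes only the values `-1`, `0`, `1`. -/
theorem sb_labeling_s_tamari (n : ℕ) (s : ℕ → ℕ)
    (lab : SDecTree n s → SDecTree n s → ℕ)
    (hlab : ∀ T Z : SDecTree n s, SDecTree.tamcov T Z →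
      ∃ b, T.TamariAscent (lab T Z) b ∧ SDecTree.IsTamRotation T Z (lab T Z) b) :
    (∀ u v w : SDecTree n s, SDecTree.tamcov u v → SDecTree.tamcov u w → v ≠ w →
      ∀ j, SDecTree.IsTamJoin v w j →
        lab u v ≠ lab u w ∧
        ∀ L : List (SDecTree n s), List.Chain' SDecTree.tamcov L →
          L.head? = some u → L.getLast? = some j →
          (lab u v ∈ labelsOf lab L ∧ lab u w ∈ labelsOf lab L) ∧
          ∀ l ∈ labelsOf lab L, l = lab u v ∨ l = lab u w) ∧
    (∀ T Z : SDecTree n s, SDecTree.IsTamari T → SDecTree.IsTamari Z →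
      SDecTree.wle T Z →
      ((∃ d : ℕ, Nonempty (ContinuousMap.HomotopyEquiv
          ↥(SDecTree.tamOrderComplex T Z)
          ↥(Metric.closedBall (0 : EuclideanSpace ℝ (Fin d)) 1))) ∨
       (∃ d : ℕ, Nonempty (ContinuousMap.HomotopyEquiv
          ↥(SDecTree.tamOrderComplex T Z)
          ↥(Metric.sphere (0 : EuclideanSpace ℝ (Fin d)) 1)))) ∧
      (∀ μ : SDecTree n s → SDecTree n s → ℤ,
        (∀ U : SDecTree n s, SDecTree.IsTamari U → μ U U = 1) →
        (∀ U V : SDecTree n s, SDecTree.IsTamari U → SDecTree.IsTamari V →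
          SDecTree.wlt U V →
          (∑ᶠ W ∈ {W : SDecTree n s | SDecTree.IsTamari W ∧ SDecTree.wle U W ∧
            SDecTree.wle W V}, μ U W) = 0) →
        μ T Z = -1 ∨ μ T Z = 0 ∨ μ T Z = 1)) := by
  refine ⟨fun u v w huv huw hne j hj => SDecTree.sb_part lab hlab u v w huv huw hne j hj, ?_⟩
  exact fun T Z hT hZ hle => SDecTree.tam_interval lab hlab T Z hT hZ hle
end

section
/- Let s be a weak composition and T an s-Tamari tree with Tamari tree ascents (a,b) and (c,d), a < c, and let Z and Q be the s-Tamari rotations of T along (a,b) and (c,d). Suppose (a,b) is not a Tamari tree ascent of Q. Then the closed interval [T, Z ∨ Q] in the s-Tamari lattice consists exactly of five elements T, Z, Q, P, Z ∨ Q (its Hasse diagram is a pentagon), with exactly two maximal chains T ⋖ Z ⋖ Z ∨ Q and T ⋖ Q ⋖ P ⋖ Z ∨ Q, whose label sequences under the labeling λ assigning to each cover relation the smaller element of its associated Tamari tree ascent are (a, c) and (c, a, a) respectively. -/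
open scoped Classical

namespace SDecTree

variable {n : ℕ} {s : ℕ → ℕ}

/-- Inductive form of the weak ancestor relation. -/
inductive Anc (T : SDecTree n s) : ℕ → ℕ → Prop
  | refl (x : ℕ) (h1 : 1 ≤ x) (h2 : x ≤ n) : Anc T x x
  | step (x y : ℕ) (h1 : 1 ≤ x) (h2 : x < n) (h : Anc T (T.parent x) y) : Anc T x y

theorem descend_iff (T : SDecTree n s) (x y : ℕ) : T.Descend x y ↔ T.Anc x y := by
  constructor
  · rintro ⟨k, hk, hm⟩
    induction k generalizing x with
    | zero =>
      have := hm 0 le_rfl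
      simp at hk this
      subst hk
      exact Anc.refl _ this.1 this.2
    | succ k ih =>
      have h0 := hm 0 (by omega)
      have h1 := hm 1 (by omega)
      simp at h0 h1
      have hx : x < n := by
        by_contra hx
        have := T.parent_out x (Or.inr (by omega))
        omega
      refine Anc.step x y h0.1 hx (ih _ hk ?_)
      intro m hmk
      exact hm (m + 1) (by omega)
  · intro h
    induction h with
    | refl x h1 h2 =>
      refine ⟨0, rfl, ?_⟩
      intro m hm
      obtain rfl : m = 0 := by omega
      exact ⟨h1, h2⟩
    | step x y h1 h2 h ih =>
      obtain ⟨k, hk, hm⟩ := ih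
      refine ⟨k + 1, hk, ?_⟩
      intro m hmk
      cases m with
      | zero => exact ⟨h1, by simpa using h2.le⟩
      | succ m => exact hm m (by omega)

theorem Anc.range {T : SDecTree n s} {x y : ℕ} (h : T.Anc x y) :
    1 ≤ x ∧ x ≤ y ∧ y ≤ n := by
  induction h with
  | refl x h1 h2 => exact ⟨h1, le_rfl, h2⟩
  | step x y h1 h2 h ih =>
    have := T.parent_gt x h1 h2
    omega

theorem Anc.trans {T : SDecTree n s} {x y z : ℕ} (h : T.Anc x y) (h' : T.Anc y z) :
    T.Anc x z := by
  induction h with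
  | refl x h1 h2 => exact h'
  | step x y h1 h2 h ih => exact Anc.step _ _ h1 h2 (ih h')

theorem Anc.comp {T : SDecTree n s} {x y z : ℕ} (h : T.Anc x y) (h' : T.Anc x z)
    (hyz : y ≤ z) : T.Anc y z := by
  induction h with
  | refl x h1 h2 => exact h'
  | step x y h1 h2 h ih =>
    cases h' with
    | refl _ h3 h4 =>
      have := h.range
      have := T.parent_gt _ h1 h2
      omega
    | step _ _ h3 h4 h5 => exact ih h5 hyz

theorem anc_root (T : SDecTree n s) {x : ℕ} (h1 : 1 ≤ x) (h2 : x ≤ n) : T.Anc x n := by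
  induction hk : n - x using Nat.strong_induction_on generalizing x with
  | _ k ih =>
    rcases h2.lt_or_eq with h | h
    · have := T.parent_gt x h1 h
      have h3 := T.parent_le x h1 h
      exact Anc.step _ _ h1 h (ih (n - T.parent x) (by omega) (by omega) h3 rfl)
    · subst h; exact Anc.refl _ h1 le_rfl

theorem Anc.child {T : SDecTree n s} {x y : ℕ} (h : T.Anc x y) (hne : x ≠ y) :
    ∃ c, T.Anc x c ∧ 1 ≤ c ∧ c < n ∧ T.parent c = y := by
  induction h with
  | refl x h1 h2 => exact absurd rfl hne
  | step x y h1 h2 h ih =>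
    by_cases h3 : T.parent x = y
    · exact ⟨x, Anc.refl _ h1 h2.le, h1, h2, h3⟩
    · obtain ⟨c, hc, hc'⟩ := ih h3
      exact ⟨c, Anc.step _ _ h1 h2 hc, hc'⟩

theorem inSub_iff (T : SDecTree n s) {y j x : ℕ} (hy : 1 ≤ y) :
    T.InSub y j x ↔ ∃ c, T.Anc x c ∧ 1 ≤ c ∧ c < n ∧ T.parent c = y ∧ T.idx c = j := by
  constructor
  · rintro ⟨c, h1, h2, h3⟩
    rw [descend_iff] at h1
    have := h1.range
    refine ⟨c, h1, by omega, ?_, h2, h3⟩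
    by_contra hc
    have := T.parent_out c (Or.inr (by omega))
    omega
  · rintro ⟨c, h1, _, _, h2, h3⟩
    exact ⟨c, (descend_iff _ _ _).2 h1, h2, h3⟩

theorem inSub_zero (T : SDecTree n s) {j x : ℕ} (h : T.InSub 0 j x) : j = 0 := by
  obtain ⟨c, h1, h2, h3⟩ := h
  rw [descend_iff] at h1
  have := h1.range
  by_cases hc : c < n
  · have := T.parent_gt c (by omega) hc
    omega
  · rw [← h3]; exact T.idx_out c (Or.inr (by omega))

theorem inSub_anc (T : SDecTree n s) {y j x : ℕ} (hy : 1 ≤ y) (h : T.InSub y j x) :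
    T.Anc x y ∧ x < y := by
  obtain ⟨c, h1, h2, h3, h4, h5⟩ := (T.inSub_iff hy).1 h
  have h6 := T.parent_gt c h2 h3
  have h7 := T.parent_le c h2 h3
  have := h1.range
  refine ⟨h1.trans (Anc.step _ _ h2 h3 (h4 ▸ Anc.refl _ (by omega) h7)), by omega⟩

theorem child_unique (T : SDecTree n s) {x c c' : ℕ} (h : T.Anc x c) (h' : T.Anc x c')
    (hc : c < n) (hc' : c' < n) (hp : T.parent c = T.parent c') : c = c' := by
  have key : ∀ c c', T.Anc x c → T.Anc x c' → c < n → c' < n →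
      T.parent c = T.parent c' → c ≤ c' → c = c' := by
    intro c c' h h' hc hc' hp hle
    have h3 := h.comp h' hle
    have h4 := h3.range
    cases h3 with
    | refl => rfl
    | step _ _ h5 h6 h7 =>
      have := h7.range
      have := T.parent_gt c' (by omega) hc'
      omega
  rcases le_total c c' with hl | hl
  · exact key _ _ h h' hc hc' hp hl
  · exact (key _ _ h' h hc' hc hp.symm hl).symm

theorem inSub_unique (T : SDecTree n s) {y j j' x : ℕ} (h : T.InSub y j x)
    (h' : T.InSub y j' x) : j = j' := by
  rcases Nat.eq_zero_or_pos y with rfl | hy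
  · rw [T.inSub_zero h, T.inSub_zero h']
  · obtain ⟨c, h1, h2, h3, h4, h5⟩ := (T.inSub_iff hy).1 h
    obtain ⟨c', h1', h2', h3', h4', h5'⟩ := (T.inSub_iff hy).1 h'
    have := T.child_unique h1 h1' h3 h3' (h4.trans h4'.symm)
    subst this
    omega

theorem card_of_inSub (T : SDecTree n s) {y j x : ℕ} (h : T.InSub y j x) : T.card y x = j := by
  have hex : ∃ j, T.InSub y j x := ⟨j, h⟩
  unfold card
  rw [dif_pos hex]
  exact T.inSub_unique hex.choose_spec h

theorem card_of_child (T : SDecTree n s) {x c : ℕ} (h : T.Anc x c) (hc : c < n) :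
    T.card (T.parent c) x = T.idx c :=
  T.card_of_inSub ⟨c, (descend_iff _ _ _).2 h, rfl, rfl⟩

theorem card_out (T : SDecTree n s) {y x : ℕ} (h : ¬ (1 ≤ x ∧ x < y ∧ y ≤ n)) :
    T.card y x = 0 := by
  by_cases hex : ∃ j, T.InSub y j x
  · obtain ⟨j, hj⟩ := hex
    rcases Nat.eq_zero_or_pos y with rfl | hy
    · rw [T.card_of_inSub hj, T.inSub_zero hj]
    · obtain ⟨h1, h2⟩ := T.inSub_anc hy hj
      have := h1.range
      omega
  · unfold card
    rw [dif_neg hex, if_neg (by tauto)]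

theorem card_le (T : SDecTree n s) (y x : ℕ) : T.card y x ≤ s y := by
  by_cases hex : ∃ j, T.InSub y j x
  · obtain ⟨j, hj⟩ := hex
    rw [T.card_of_inSub hj]
    rcases Nat.eq_zero_or_pos y with rfl | hy
    · rw [T.inSub_zero hj]; omega
    · obtain ⟨c, h1, h2, h3, h4, h5⟩ := (T.inSub_iff hy).1 hj
      rw [← h4, ← h5]; exact T.idx_le c h2 h3
  · unfold card
    rw [dif_neg hex]
    split_ifs <;> omega

/-- In a Tamari tree a smaller non-descendant is strictly to the left. -/
theorem not_anc (T : SDecTree n s) (hT : T.IsTamari) {x y : ℕ} (h1 : 1 ≤ x) (hxy : x < y)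
    (hy : y ≤ n) (h : ¬ T.Anc x y) :
    T.card y x = 0 ∧ ∃ z, y < z ∧ z ≤ n ∧ T.card z x < T.card z y := by
  have hex : ∃ z, T.Anc x z ∧ T.Anc y z :=
    ⟨n, T.anc_root h1 (by omega), T.anc_root (by omega) hy⟩
  obtain ⟨⟨hx, hy'⟩, hmin⟩ : (T.Anc x (Nat.find hex) ∧ T.Anc y (Nat.find hex)) ∧
      ∀ m < Nat.find hex, ¬ (T.Anc x m ∧ T.Anc y m) :=
    ⟨Nat.find_spec hex, fun m hm => Nat.find_min hex hm⟩
  generalize Nat.find hex = z at *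
  have hyz : y ≠ z := by rintro rfl; exact h hx
  have hr := hy'.range
  have hr2 := hx.range
  obtain ⟨c, hc1, hc2, hc3, hc4⟩ := hx.child (by omega)
  obtain ⟨c', hc1', hc2', hc3', hc4'⟩ := hy'.child hyz
  have e1 := T.card_of_child hc1 hc3
  have e2 := T.card_of_child hc1' hc3'
  rw [hc4] at e1
  rw [hc4'] at e2
  have hle := hT x y z hxy (by omega)
  have hne : T.idx c ≠ T.idx c' := by
    intro he
    have := T.slot_inj c c' hc2 hc3 hc2' hc3' (hc4.trans hc4'.symm) he
    subst this
    have := T.parent_gt c hc2 hc3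
    exact hmin c (by omega) ⟨hc1, hc1'⟩
  have hlt : T.idx c < T.idx c' := by omega
  refine ⟨?_, z, by omega, hr.2.2, by omega⟩
  have hno : ¬ ∃ j, T.InSub y j x := by
    rintro ⟨j, hj⟩
    exact h (T.inSub_anc (by omega) hj).1
  have hl : T.LeftOf x y :=
    ⟨z, T.idx c, T.idx c', hlt, ⟨c, (descend_iff _ _ _).2 hc1, hc4, rfl⟩,
      ⟨c', (descend_iff _ _ _).2 hc1', hc4', rfl⟩⟩
  unfold card
  rw [dif_neg hno, if_neg (by tauto)]

theorem anc_eq (T : SDecTree n s) (hT : T.IsTamari) {x y z : ℕ} (h : T.Anc x y)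
    (hyz : y < z) : T.card z x = T.card z y := by
  have hr := h.range
  by_cases hz : z ≤ n
  · by_cases h2 : T.Anc y z
    · obtain ⟨c, hc1, hc2, hc3, hc4⟩ := h2.child (by omega)
      have e1 := T.card_of_child hc1 hc3
      have e2 := T.card_of_child (h.trans hc1) hc3
      rw [← hc4, e1, e2]
    · have h3 : ¬ T.Anc x z := fun h3 => h2 (h.comp h3 hyz.le)
      rw [(T.not_anc hT hr.1 (by omega) hz h3).1, (T.not_anc hT (by omega) hyz hz h2).1]
  · rw [T.card_out (by omega), T.card_out (by omega)]

end SDecTree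

/-- Axioms of inversion functions of `s`-Tamari trees. -/
structure TI (n : ℕ) (s : ℕ → ℕ) (I : ℕ → ℕ → ℕ) : Prop where
  le : ∀ y x, I y x ≤ s y
  out : ∀ y x, ¬ (1 ≤ x ∧ x < y ∧ y ≤ n) → I y x = 0
  tam : ∀ x y z, x < y → y < z → I z x ≤ I z y
  tr : ∀ x y z, x < y → y < z → 0 < I y x → I z x = I z y

/-- `p` is the parent of `x`, read off from the inversion function. -/
structure Par (n : ℕ) (I : ℕ → ℕ → ℕ) (x p : ℕ) : Prop where
  pos : 1 ≤ x
  lt : x < p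
  le : p ≤ n
  eq : ∀ z, p < z → I z x = I z p
  min : ∀ y, x < y → y < p → ∃ z, y < z ∧ I z x < I z y

namespace SDecTree

variable {n : ℕ} {s : ℕ → ℕ}

theorem ti (T : SDecTree n s) (hT : T.IsTamari) : TI n s T.card where
  le := T.card_le
  out := fun y x h => T.card_out h
  tam := hT
  tr := by
    intro x y z hxy hyz h
    by_cases hr : 1 ≤ x ∧ x < y ∧ y ≤ n
    · by_cases ha : T.Anc x y
      · exact T.anc_eq hT ha hyz
      · have := (T.not_anc hT hr.1 hxy hr.2.2 ha).1
        omega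
    · rw [T.card_out hr] at h; omega

theorem par_parent (T : SDecTree n s) (hT : T.IsTamari) {x : ℕ} (h1 : 1 ≤ x) (h2 : x < n) :
    Par n T.card x (T.parent x) := by
  have h3 := T.parent_gt x h1 h2
  have h4 := T.parent_le x h1 h2
  have ha : T.Anc x (T.parent x) := Anc.step _ _ h1 h2 (Anc.refl _ (by omega) h4)
  refine ⟨h1, h3, h4, fun z hz => T.anc_eq hT ha hz, ?_⟩
  intro y hxy hy
  have hna : ¬ T.Anc x y := by
    intro h
    cases h with
    | refl => omega
    | step _ _ _ _ h5 => have := h5.range; omega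
  obtain ⟨_, z, hz, _, hlt⟩ := T.not_anc hT h1 hxy (by omega) hna
  exact ⟨z, hz, hlt⟩

end SDecTree

theorem Par.unique {n : ℕ} {I : ℕ → ℕ → ℕ} {x p q : ℕ} (hp : Par n I x p) (hq : Par n I x q) :
    p = q := by
  rcases lt_trichotomy p q with h | h | h
  · obtain ⟨z, hz, hlt⟩ := hq.min p hp.lt h
    have := hp.eq z hz
    omega
  · exact h
  · obtain ⟨z, hz, hlt⟩ := hp.min q hq.lt h
    have := hq.eq z hz
    omega

theorem TI.exists_par {n : ℕ} {s : ℕ → ℕ} {I : ℕ → ℕ → ℕ} (h : TI n s I) {x : ℕ}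
    (h1 : 1 ≤ x) (h2 : x < n) : ∃ p, Par n I x p := by
  have hex : ∃ p, x < p ∧ p ≤ n ∧ ∀ z, p < z → I z x = I z p := by
    refine ⟨n, h2, le_rfl, ?_⟩
    intro z hz
    rw [h.out z x (by omega), h.out z n (by omega)]
  obtain ⟨hsp, hmin⟩ := And.intro (Nat.find_spec hex) (fun m => Nat.find_min (m := m) hex)
  generalize Nat.find hex = p at *
  refine ⟨p, h1, hsp.1, hsp.2.1, hsp.2.2, ?_⟩
  intro y hxy hyp
  by_contra hcon
  push Not at hcon
  refine hmin y hyp ⟨hxy, by omega, fun z hz => ?_⟩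
  exact le_antisymm (h.tam x y z hxy hz) (hcon z hz)

namespace SDecTree

variable {n : ℕ} {s : ℕ → ℕ}

theorem parent_eq_iff (T : SDecTree n s) (hT : T.IsTamari) {x p : ℕ} (h1 : 1 ≤ x) (h2 : x < n) :
    T.parent x = p ↔ Par n T.card x p :=
  ⟨fun h => h ▸ T.par_parent hT h1 h2, fun h => (T.par_parent hT h1 h2).unique h⟩

theorem eq_of_card (T U : SDecTree n s) (hT : T.IsTamari) (hU : U.IsTamari)
    (h : T.card = U.card) : T = U := by
  have hp : T.parent = U.parent := by
    funext x
    by_cases hx : 1 ≤ x ∧ x < n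
    · rw [T.parent_eq_iff hT hx.1 hx.2, h]
      exact U.par_parent hU hx.1 hx.2
    · rw [T.parent_out x (by omega), U.parent_out x (by omega)]
  have hi : T.idx = U.idx := by
    funext x
    by_cases hx : 1 ≤ x ∧ x < n
    · rw [← T.card_of_child (Anc.refl x hx.1 hx.2.le) hx.2,
        ← U.card_of_child (Anc.refl x hx.1 hx.2.le) hx.2, h, hp]
    · rw [T.idx_out x (by omega), U.idx_out x (by omega)]
  cases T
  cases U
  simp only at hp hi
  subst hp hi
  rfl

end SDecTree

/-- Every function satisfying the axioms is the inversion function of a tree. -/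
theorem TI.exists_tree {n : ℕ} {s : ℕ → ℕ} {I : ℕ → ℕ → ℕ} (h : TI n s I) :
    ∃ T : SDecTree n s, T.IsTamari ∧ T.card = I := by
  have hf : ∀ x, ∃ p, (1 ≤ x ∧ x < n → Par n I x p) ∧ (x = 0 ∨ n ≤ x → p = 0) := by
    intro x
    by_cases hx : 1 ≤ x ∧ x < n
    · obtain ⟨p, hp⟩ := h.exists_par hx.1 hx.2
      exact ⟨p, fun _ => hp, fun h => by omega⟩
    · exact ⟨0, fun h => absurd h hx, fun _ => rfl⟩
  choose par hpar hpo using hf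
  let T : SDecTree n s :=
    { parent := par
      idx := fun x => I (par x) x
      parent_gt := fun v h1 h2 => (hpar v ⟨h1, h2⟩).lt
      parent_le := fun v h1 h2 => (hpar v ⟨h1, h2⟩).le
      idx_le := fun v h1 h2 => h.le _ _
      slot_inj := by
        have key : ∀ v w, 1 ≤ v → v < n → 1 ≤ w → w < n → par v = par w →
            I (par v) v = I (par w) w → v < w → False := by
          intro v w hv1 hv2 hw1 hw2 hp hi hvw
          have pv := hpar v ⟨hv1, hv2⟩
          have pw := hpar w ⟨hw1, hw2⟩
          rw [hp] at pv hi
          obtain ⟨z, hz, hlt⟩ := pv.min w hvw pw.lt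
          rcases lt_trichotomy z (par w) with h3 | h3 | h3
          · obtain ⟨z', hz', hlt'⟩ := pw.min z hz h3
            have := h.tr w z z' hz hz' (by omega)
            omega
          · subst h3; omega
          · have := pv.eq z h3
            have := pw.eq z h3
            omega
        intro v w hv1 hv2 hw1 hw2 hp hi
        rcases lt_trichotomy v w with h3 | h3 | h3
        · exact (key v w hv1 hv2 hw1 hw2 hp hi h3).elim
        · exact h3
        · exact (key w v hw1 hw2 hv1 hv2 hp.symm hi.symm h3).elim
      parent_out := hpo
      idx_out := fun v hv => h.out _ _ (by have := hpo v hv; omega) }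
  have anc1 : ∀ x y, T.Anc x y → ∀ z, y < z → I z x = I z y := by
    intro x y ha
    induction ha with
    | refl x h1 h2 => intro z _; rfl
    | step x y h1 h2 ha ih =>
      intro z hz
      have hr := ha.range
      rw [← ih z hz]
      exact (hpar x ⟨h1, h2⟩).eq z (lt_of_le_of_lt hr.2.1 hz)
  have anc2 : ∀ k x y, n - x = k → 1 ≤ x → x ≤ y → y ≤ n → (∀ z, y < z → I z x = I z y) →
      T.Anc x y := by
    intro k
    induction k using Nat.strong_induction_on with
    | _ k ih =>
      intro x y hk h1 hxy hy hz
      rcases hxy.lt_or_eq with hlt | rfl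
      · have hp := hpar x ⟨h1, by omega⟩
        have hle : par x ≤ y := by
          by_contra hcon
          obtain ⟨z, hz1, hz2⟩ := hp.min y hlt (by omega)
          have := hz z hz1
          omega
        have hpl := hp.lt
        refine SDecTree.Anc.step _ _ h1 (by omega) (ih (n - par x) (by omega) _ _ rfl ?_ hle hy ?_)
        · change 1 ≤ par x
          omega
        · intro z hz'
          have := hp.eq z (by omega)
          have := hz z hz'
          change I z (par x) = I z y
          omega
      · exact SDecTree.Anc.refl _ h1 hy
  have inS : ∀ x y, x < y → T.Anc x y → T.InSub y (I y x) x := by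
    intro x y hxy ha
    obtain ⟨c, hc1, hc2, hc3, hc4⟩ := ha.child (by omega)
    refine ⟨c, (SDecTree.descend_iff _ _ _).2 hc1, hc4, ?_⟩
    change I (T.parent c) c = _
    rw [hc4]
    have := T.parent_gt c hc2 hc3
    exact (anc1 x c hc1 y (by omega)).symm
  have hcard : T.card = I := by
    funext y x
    by_cases hr : 1 ≤ x ∧ x < y ∧ y ≤ n
    · obtain ⟨h1, h2, h3⟩ := hr
      by_cases ha : T.Anc x y
      · exact T.card_of_inSub (inS x y h2 ha)
      · have h0 : I y x = 0 := by
          by_contra h0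
          exact ha (anc2 _ x y rfl h1 h2.le h3 (fun z hz => h.tr x y z h2 hz (by omega)))
        have hex : ∃ k, ∃ z, z + k = n ∧ y < z ∧ I z x < I z y := by
          by_contra hcon
          push Not at hcon
          refine ha (anc2 _ x y rfl h1 h2.le h3 (fun z hz => ?_))
          by_cases hzn : z ≤ n
          · exact le_antisymm (h.tam _ _ _ h2 hz) (hcon (n - z) z (by omega) hz)
          · rw [h.out z x (by omega), h.out z y (by omega)]
        obtain ⟨⟨z, hzk, hyz, hlt⟩, hmin⟩ :=
          And.intro (Nat.find_spec hex) (fun m => Nat.find_min (m := m) hex)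
        generalize Nat.find hex = k at *
        have hay : T.Anc y z :=
          anc2 _ y z rfl (by omega) hyz.le (by omega)
            (fun z' hz' => h.tr y z z' hyz hz' (by omega))
        have hax : T.Anc x z := by
          refine anc2 _ x z rfl h1 (by omega) (by omega) (fun z' hz' => ?_)
          rw [← anc1 y z hay z' hz']
          by_cases hzn : z' ≤ n
          · refine le_antisymm (h.tam _ _ _ h2 (by omega)) ?_
            by_contra hcon
            exact hmin (n - z') (by omega) ⟨z', by omega, by omega, by omega⟩
          · rw [h.out z' x (by omega), h.out z' y (by omega)]
        have hl : T.LeftOf x y := ⟨z, _, _, hlt, inS x z (by omega) hax, inS y z hyz hay⟩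
        have hno : ¬ ∃ j, T.InSub y j x := by
          rintro ⟨j, hj⟩
          exact ha (T.inSub_anc (by omega) hj).1
        rw [h0]
        unfold SDecTree.card
        rw [dif_neg hno, if_neg (by tauto)]
    · rw [T.card_out hr, h.out _ _ hr]
  refine ⟨T, ?_, hcard⟩
  intro x y z hxy hyz
  rw [hcard]
  exact h.tam x y z hxy hyz

/-- The set of vertices moved by a rotation at `a`. -/
def Mv (I : ℕ → ℕ → ℕ) (a x : ℕ) : Prop := x = a ∨ (x < a ∧ 0 < I a x)

/-- Effect of a Tamari rotation on inversion functions. -/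
noncomputable def rot (I : ℕ → ℕ → ℕ) (a b : ℕ) : ℕ → ℕ → ℕ := fun y x =>
  I y x + if y = b ∧ Mv I a x then 1 else 0

theorem Mv.eq {n : ℕ} {s : ℕ → ℕ} {I : ℕ → ℕ → ℕ} (h : TI n s I) {a x z : ℕ}
    (hx : Mv I a x) (hz : a < z) : I z x = I z a := by
  rcases hx with rfl | ⟨h1, h2⟩
  · rfl
  · exact h.tr x a z h1 hz h2

theorem Par.sib {n : ℕ} {s : ℕ → ℕ} {I : ℕ → ℕ → ℕ} (h : TI n s I) {a b : ℕ}
    (hp : Par n I a b) {y : ℕ} (hy : a < y) (hyb : y < b) : I b a < I b y := by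
  induction hk : b - y using Nat.strong_induction_on generalizing y with
  | _ k ih =>
    obtain ⟨z, hz, hlt⟩ := hp.min y hy hyb
    rcases lt_trichotomy z b with h3 | h3 | h3
    · have := ih (b - z) (by omega) (y := z) (by omega) h3 rfl
      have := h.tr y z b hz h3 (by omega)
      omega
    · subst h3; exact hlt
    · have := hp.eq z h3
      have := h.tam y b z hyb h3
      omega

theorem rot_ti {n : ℕ} {s : ℕ → ℕ} {I : ℕ → ℕ → ℕ} (h : TI n s I) {a b : ℕ}
    (hp : Par n I a b) (hs : I b a < s b) : TI n s (rot I a b) where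
  le := by
    intro y x
    unfold rot
    split_ifs with hc
    · obtain ⟨rfl, hm⟩ := hc
      rw [hm.eq h hp.lt]; omega
    · exact h.le y x
  out := by
    intro y x hr
    have h1 := hp.pos
    have h2 := hp.lt
    have h3 := hp.le
    unfold rot
    rw [h.out y x hr, if_neg]
    rintro ⟨rfl, rfl | ⟨h4, h5⟩⟩
    · omega
    · have : x = 0 := by omega
      subst this
      rw [h.out a 0 (by omega)] at h5
      omega
  tam := by
    intro x y z hxy hyz
    have h1 := h.tam x y z hxy hyz
    unfold rot
    split_ifs with hx hy hy
    · omega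
    · obtain ⟨rfl, hm⟩ := hx
      have e1 := hm.eq h hp.lt
      rcases lt_trichotomy y a with h3 | h3 | h3
      · exfalso
        refine hy ⟨rfl, Or.inr ⟨h3, ?_⟩⟩
        rcases hm with h4 | ⟨h4, h5⟩
        · omega
        · exact lt_of_lt_of_le h5 (h.tam x y a hxy h3)
      · exact absurd ⟨rfl, Or.inl h3⟩ hy
      · have := hp.sib h h3 hyz
        omega
    · omega
    · omega
  tr := by
    intro x y z hxy hyz
    unfold rot
    intro hpos
    by_cases h0 : 0 < I y x
    · rw [h.tr x y z hxy hyz h0]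
      congr 1
      have hiff : (z = b ∧ Mv I a x) ↔ (z = b ∧ Mv I a y) := by
        constructor
        · rintro ⟨rfl, hm⟩
          refine ⟨rfl, ?_⟩
          rcases lt_trichotomy y a with h3 | h3 | h3
          · rcases hm with h4 | ⟨h4, h5⟩
            · omega
            · exact Or.inr ⟨h3, lt_of_lt_of_le h5 (h.tam x y a hxy h3)⟩
          · exact Or.inl h3
          · have := hp.sib h h3 hyz
            have := h.tr x y z hxy hyz h0
            have := hm.eq h hp.lt
            omega
        · rintro ⟨rfl, hm⟩
          refine ⟨rfl, Or.inr ?_⟩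
          rcases hm with rfl | ⟨h4, h5⟩
          · exact ⟨hxy, h0⟩
          · have := h.tr x y a hxy h4 h0
            exact ⟨by omega, by omega⟩
      simp only [hiff]
    · have hc : y = b ∧ Mv I a x := by
        by_contra hc
        rw [if_neg hc] at hpos
        omega
      obtain ⟨rfl, hm⟩ := hc
      have hl := hp.lt
      rw [if_neg (by omega), if_neg (by omega), hm.eq h (by omega), hp.eq z hyz]

theorem TI.isTrans {n : ℕ} {s : ℕ → ℕ} {I : ℕ → ℕ → ℕ} (h : TI n s I) : IsTransitiveInv I := by
  intro x y z hxy hyz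
  rcases Nat.eq_zero_or_pos (I y x) with h0 | h0
  · exact Or.inl h0
  · exact Or.inr (h.tr x y z hxy hyz h0).ge

theorem tc_rot {n : ℕ} {s : ℕ → ℕ} {I : ℕ → ℕ → ℕ} (h : TI n s I) {a b : ℕ}
    (hp : Par n I a b) (hs : I b a < s b) : tcInv (addInv s I b a) = rot I a b := by
  funext y x
  have hmem : rot I a b y x ∈ {m | ∃ J : ℕ → ℕ → ℕ, IsTransitiveInv J ∧
      (∀ y' x', addInv s I b a y' x' ≤ J y' x') ∧ J y x = m} := by
    refine ⟨_, (rot_ti h hp hs).isTrans, ?_, rfl⟩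
    intro y' x'
    unfold addInv rot
    split_ifs with h1 h2 h2
    · omega
    · exact absurd ⟨h1.1, Or.inl h1.2⟩ h2
    · omega
    · omega
  refine le_antisymm (Nat.sInf_le hmem) (le_csInf ⟨_, hmem⟩ ?_)
  rintro m ⟨J, hJ, hle, rfl⟩
  have hI : ∀ y' x', I y' x' ≤ J y' x' := by
    intro y' x'
    refine le_trans ?_ (hle y' x')
    unfold addInv
    split_ifs
    · have := h.le y' x'
      omega
    · exact le_rfl
  have hba : I b a + 1 ≤ J b a := by
    refine le_trans ?_ (hle b a)
    unfold addInv
    rw [if_pos ⟨rfl, rfl⟩]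
    omega
  unfold rot
  split_ifs with hc
  · obtain ⟨rfl, hm⟩ := hc
    rw [hm.eq h hp.lt]
    rcases hm with rfl | ⟨h4, h5⟩
    · exact hba
    · have := hI a x
      rcases hJ x a y h4 hp.lt with h6 | h6 <;> omega
  · exact hI y x

namespace SDecTree

variable {n : ℕ} {s : ℕ → ℕ}

theorem tamAscent_iff (T : SDecTree n s) (hT : T.IsTamari) (a b : ℕ) :
    T.TamariAscent a b ↔ Par n T.card a b ∧ T.card b a < s b := by
  constructor
  · rintro ⟨h1, h2, h3, h4⟩
    exact ⟨(T.parent_eq_iff hT h1 h2).1 h3, h4⟩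
  · rintro ⟨h1, h2⟩
    have h3 := h1.lt
    have h4 := h1.le
    have h5 := h1.pos
    exact ⟨h5, by omega, (T.parent_eq_iff hT h5 (by omega)).2 h1, h2⟩

theorem tamRot_iff (T Z : SDecTree n s) (hT : T.IsTamari) (a b : ℕ) :
    T.IsTamRotation Z a b ↔ Par n T.card a b ∧ T.card b a < s b ∧ Z.card = rot T.card a b := by
  unfold IsTamRotation
  rw [T.tamAscent_iff hT]
  constructor
  · rintro ⟨⟨h1, h2⟩, h3⟩
    refine ⟨h1, h2, ?_⟩
    funext y x
    by_cases hr : 1 ≤ x ∧ x < y ∧ y ≤ n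
    · rw [h3 y x hr.1 hr.2.1 hr.2.2, tc_rot (T.ti hT) h1 h2]
    · rw [Z.card_out hr, (rot_ti (T.ti hT) h1 h2).out _ _ hr]
  · rintro ⟨h1, h2, h3⟩
    refine ⟨⟨h1, h2⟩, ?_⟩
    intro y x _ _ _
    rw [h3, tc_rot (T.ti hT) h1 h2]

end SDecTree

theorem still_ascent {n : ℕ} {s : ℕ → ℕ} {t : ℕ → ℕ → ℕ} (h : TI n s t) {a b c d : ℕ}
    (hac : a < c) (hab : Par n t a b) (hs : t b a < s b) (hcd : Par n t c d)
    (hn : ¬ (b = c ∧ t c a = 0)) :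
    Par n (rot t c d) a b ∧ rot t c d b a < s b := by
  have hbc : 0 < t c a → b ≤ c := by
    intro h0
    by_contra hcon
    obtain ⟨z, hz, hlt⟩ := hab.min c hac (by omega)
    have := h.tr a c z hac hz h0
    omega
  have hl := hab.lt
  have hl' := hcd.lt
  refine ⟨⟨hab.pos, hab.lt, hab.le, ?_, ?_⟩, ?_⟩
  · intro z hz
    unfold rot
    rw [hab.eq z hz]
    congr 1
    have hiff : Mv t c a ↔ Mv t c b := by
      constructor
      · rintro (h1 | ⟨h1, h2⟩)
        · omega
        · rcases (hbc h2).lt_or_eq with h3 | h3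
          · exact Or.inr ⟨h3, by rw [← hab.eq c h3]; exact h2⟩
          · exact Or.inl h3
      · rintro (h1 | ⟨h1, h2⟩)
        · refine Or.inr ⟨hac, ?_⟩
          by_contra h0
          exact hn ⟨h1, by omega⟩
        · exact Or.inr ⟨hac, by rw [hab.eq c h1]; exact h2⟩
    simp only [hiff]
  · intro y hay hyb
    obtain ⟨z, hz, hlt⟩ := hab.min y hay hyb
    refine ⟨z, hz, ?_⟩
    unfold rot
    have himp : Mv t c a → Mv t c y := by
      rintro (h1 | ⟨h1, h2⟩)
      · omega
      · have h3 := hbc h2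
        exact Or.inr ⟨by omega, lt_of_lt_of_le h2 (h.tam a y c hay (by omega))⟩
    by_cases h1 : z = d ∧ Mv t c a
    · rw [if_pos h1, if_pos ⟨h1.1, himp h1.2⟩]; omega
    · rw [if_neg h1]; omega
  · unfold rot
    rw [if_neg]
    · exact hs
    · rintro ⟨rfl, h1 | ⟨h1, h2⟩⟩
      · omega
      · have := hbc h2
        omega

section Pent

variable {n : ℕ} {s : ℕ → ℕ} {t : ℕ → ℕ → ℕ} {a c d : ℕ}

theorem pent_mv0 (h : TI n s t) (hac : Par n t a c) (h0 : t c a = 0) {x : ℕ}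
    (hx : Mv t a x) : ¬ Mv t c x := by
  have h1 := hac.lt
  have h2 := hx.eq h h1
  rintro (rfl | ⟨h3, h4⟩)
  · rcases hx with h3 | ⟨h3, _⟩ <;> omega
  · omega

theorem pent_pq (hac : Par n t a c) (hcd : Par n t c d)
    (hd : t d c < s d) (h0 : t c a = 0) :
    Par n (rot t c d) a d ∧ rot t c d d a < s d := by
  have h1 := hac.lt
  have h2 := hcd.lt
  have hna : ¬ Mv t c a := by
    rintro (h3 | ⟨h3, h4⟩) <;> omega
  have hna' : ∀ z, rot t c d z a = t z a := by
    intro z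
    unfold rot
    rw [if_neg (by tauto)]; rfl
  have hge : ∀ z x, t z x ≤ rot t c d z x := fun z x => Nat.le_add_right _ _
  refine ⟨⟨hac.pos, by omega, hcd.le, ?_, ?_⟩, ?_⟩
  · intro z hz
    rw [hna', hac.eq z (by omega), hcd.eq z hz]
    unfold rot
    rw [if_neg (by omega)]; rfl
  · intro y hay hyd
    rcases lt_trichotomy y c with h3 | h3 | h3
    · obtain ⟨z, hz, hlt⟩ := hac.min y hay h3
      have := hge z y
      exact ⟨z, hz, by rw [hna']; omega⟩
    · subst h3
      refine ⟨d, hyd, ?_⟩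
      rw [hna', hac.eq d h2]
      unfold rot
      rw [if_pos ⟨rfl, Or.inl rfl⟩]; omega
    · obtain ⟨z, hz, hlt⟩ := hcd.min y h3 hyd
      have := hge z y
      have := hac.eq z (by omega)
      exact ⟨z, hz, by rw [hna']; omega⟩
  · rw [hna', hac.eq d h2]; exact hd

theorem pent_mvq (hac : Par n t a c) (hcd : Par n t c d) (x : ℕ) :
    Mv (rot t c d) a x ↔ Mv t a x := by
  have h1 := hac.lt
  have h2 := hcd.lt
  have : rot t c d a x = t a x := by
    unfold rot
    rw [if_neg (by omega)]; rfl
  unfold Mv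
  rw [this]

/-- Value of the inversion function of `P`. -/
theorem pent_p (hac : Par n t a c) (hcd : Par n t c d) (y x : ℕ) :
    rot (rot t c d) a d y x =
      t y x + (if y = d ∧ Mv t c x then 1 else 0) + (if y = d ∧ Mv t a x then 1 else 0) := by
  unfold rot
  have := pent_mvq hac hcd x
  unfold rot at this
  simp only [this]

theorem pent_w (h : TI n s t) (hac : Par n t a c) (hcd : Par n t c d)
    (hs : t c a < s c) (h0 : t c a = 0) :
    Par n (rot (rot t c d) a d) a c ∧ rot (rot t c d) a d c a < s c := by
  have h1 := hac.lt
  have h2 := hcd.lt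
  have hna : ¬ Mv t c a := pent_mv0 h hac h0 (Or.inl rfl)
  have hnc : ¬ Mv t a c := by
    rintro (h3 | ⟨h3, h4⟩) <;> omega
  have ha : Mv t a a := Or.inl rfl
  have hc : Mv t c c := Or.inl rfl
  refine ⟨⟨hac.pos, by omega, hac.le, ?_, ?_⟩, ?_⟩
  · intro z hz
    rw [pent_p hac hcd, pent_p hac hcd, hac.eq z hz]
    simp [hna, hnc, ha, hc]
  · intro y hay hyc
    obtain ⟨z, hz, hlt⟩ := hac.min y hay hyc
    have hzd : z ≠ d := by
      rintro rfl
      have := hac.eq z h2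
      have := h.tam y c z hyc h2
      omega
    refine ⟨z, hz, ?_⟩
    rw [pent_p hac hcd, pent_p hac hcd]
    simpa [hzd] using hlt
  · rw [pent_p hac hcd, if_neg (by omega), if_neg (by omega)]
    exact hs

/-- Value of the inversion function of `W`. -/
theorem pent_wval (hac : Par n t a c) (hcd : Par n t c d) (y x : ℕ) :
    rot (rot (rot t c d) a d) a c y x =
      t y x + (if y = d ∧ Mv t c x then 1 else 0) + (if y = d ∧ Mv t a x then 1 else 0)
        + (if y = c ∧ Mv t a x then 1 else 0) := by
  have h1 := hac.lt
  have h2 := hcd.lt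
  have e : rot (rot t c d) a d a x = t a x := by
    rw [pent_p hac hcd, if_neg (by omega), if_neg (by omega)]; rfl
  have : Mv (rot (rot t c d) a d) a x ↔ Mv t a x := by
    unfold Mv
    rw [e]
  rw [rot, pent_p hac hcd]
  simp only [this]

theorem pent_zw (hac : Par n t a c) (hcd : Par n t c d) (hd : t d c < s d) :
    Par n (rot t a c) c d ∧ rot t a c d c < s d := by
  have h1 := hac.lt
  have h2 := hcd.lt
  have e : ∀ z x, c < z → rot t a c z x = t z x := by
    intro z x hz
    unfold rot
    rw [if_neg (by omega)]; rfl
  refine ⟨⟨hcd.pos, h2, hcd.le, ?_, ?_⟩, ?_⟩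
  · intro z hz
    rw [e _ _ (by omega), e _ _ (by omega), hcd.eq z hz]
  · intro y hcy hyd
    obtain ⟨z, hz, hlt⟩ := hcd.min y hcy hyd
    exact ⟨z, hz, by rw [e _ _ (by omega), e _ _ (by omega)]; exact hlt⟩
  · rw [e _ _ h2]; exact hd

theorem pent_zwval (h : TI n s t) (hac : Par n t a c) (hcd : Par n t c d) (h0 : t c a = 0) :
    rot (rot t a c) c d = rot (rot (rot t c d) a d) a c := by
  have h1 := hac.lt
  have h2 := hcd.lt
  funext y x
  rw [pent_wval hac hcd]
  have hm : Mv (rot t a c) c x ↔ Mv t c x ∨ Mv t a x := by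
    constructor
    · rintro (h3 | ⟨h3, h4⟩)
      · exact Or.inl (Or.inl h3)
      · by_cases h5 : Mv t a x
        · exact Or.inr h5
        · unfold rot at h4
          rw [if_neg (by tauto)] at h4
          exact Or.inl (Or.inr ⟨h3, h4⟩)
    · rintro ((h3 | ⟨h3, h4⟩) | h3)
      · exact Or.inl h3
      · refine Or.inr ⟨h3, ?_⟩
        unfold rot; omega
      · refine Or.inr ⟨?_, ?_⟩
        · rcases h3 with h4 | ⟨h4, _⟩ <;> omega
        · unfold rot
          rw [if_pos ⟨rfl, h3⟩]; omega
  have hdis := fun hx => pent_mv0 h hac h0 (x := x) hx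
  rw [rot]
  simp only [hm]
  unfold rot
  by_cases hA : Mv t a x
  · have hC := hdis hA
    simp [hA, hC]
    omega
  · simp [hA]

/-- Classification of the inversion functions in the interval. -/
theorem pent_class (h : TI n s t) (hac : Par n t a c) (hcd : Par n t c d) (h0 : t c a = 0)
    {u : ℕ → ℕ → ℕ} (hu : TI n s u) (h1 : ∀ y x, t y x ≤ u y x)
    (h2 : ∀ y x, u y x ≤ rot (rot (rot t c d) a d) a c y x) :
    u = t ∨ u = rot t a c ∨ u = rot t c d ∨ u = rot (rot t c d) a d ∨
      u = rot (rot (rot t c d) a d) a c := by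
  have l1 := hac.lt
  have l2 := hcd.lt
  have hdis := fun x hx => pent_mv0 h hac h0 (x := x) hx
  have ha : Mv t a a := Or.inl rfl
  have hc : Mv t c c := Or.inl rfl
  have hup : ∀ y x, u y x ≤ t y x + (if y = d ∧ Mv t c x then 1 else 0)
      + (if y = d ∧ Mv t a x then 1 else 0) + (if y = c ∧ Mv t a x then 1 else 0) := by
    intro y x
    rw [← pent_wval hac hcd]; exact h2 y x
  have hMle : ∀ e x, Mv t e x → x = e ∨ x < e := fun e x hx => hx.imp id And.left
  -- homogeneity of the blocks
  have hom : ∀ e z x, e < z → Mv t e x → u z x = u z e := by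
    intro e z x hz hx
    rcases hx with rfl | ⟨h3, h4⟩
    · rfl
    · exact hu.tr x e z h3 hz (lt_of_lt_of_le h4 (h1 e x))
  have tom : ∀ e z x, e < z → Mv t e x → t z x = t z e := fun e z x hz hx => hx.eq h hz
  have tda : t d a = t d c := hac.eq d l2
  have lca := h1 c a
  have lda := h1 d a
  have ldc := h1 d c
  have uca := hup c a
  have uda := hup d a
  have udc := hup d c
  have hnc : ¬ Mv t a c := fun hh => hdis c hh hc
  have hna : ¬ Mv t c a := hdis a ha
  have hdc : d ≠ c := by omega
  have hcd' : c ≠ d := by omega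
  simp [hna, hnc, ha, hc, hdc, hcd'] at uca uda udc
  have tm := hu.tam a c d l1 l2
  have tt : 0 < u c a → u d a = u d c := hu.tr a c d l1 l2
  have main : ∀ y x, u y x = t y x + (if y = d ∧ Mv t c x then u d c - t d c else 0)
      + (if y = d ∧ Mv t a x then u d a - t d a else 0)
      + (if y = c ∧ Mv t a x then u c a - t c a else 0) := by
    intro y x
    have b1 := h1 y x
    have b2 := hup y x
    by_cases hA : Mv t a x
    · have hC := hdis x hA
      have e1 := hom a c x l1 hA
      have e2 := hom a d x (by omega) hA
      have e3 := tom a c x l1 hA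
      have e4 := tom a d x (by omega) hA
      simp only [hA, hC, and_true, and_false, if_false] at b2 ⊢
      by_cases hyd : y = d
      · subst hyd
        simp [hdc]
        omega
      · by_cases hyc : y = c
        · subst hyc
          simp [hcd']
          omega
        · simp [hyd, hyc] at b2 ⊢
          omega
    · by_cases hC : Mv t c x
      · have e2 := hom c d x l2 hC
        have e4 := tom c d x l2 hC
        simp only [hA, hC, and_true, and_false, if_false] at b2 ⊢
        by_cases hyd : y = d
        · subst hyd
          simp
          omega
        · simp [hyd] at b2 ⊢
          omega
      · simp [hA, hC] at b2 ⊢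
        omega
  have cases5 : (u c a = t c a ∧ u d a = t d a ∧ u d c = t d c) ∨
      (u c a = t c a + 1 ∧ u d a = t d a ∧ u d c = t d c) ∨
      (u c a = t c a ∧ u d a = t d a ∧ u d c = t d c + 1) ∨
      (u c a = t c a ∧ u d a = t d a + 1 ∧ u d c = t d c + 1) ∨
      (u c a = t c a + 1 ∧ u d a = t d a + 1 ∧ u d c = t d c + 1) := by
    by_cases hpos : 0 < u c a
    · have := tt hpos
      omega
    · omega
  rcases cases5 with ⟨e1, e2, e3⟩ | ⟨e1, e2, e3⟩ | ⟨e1, e2, e3⟩ | ⟨e1, e2, e3⟩ | ⟨e1, e2, e3⟩ <;>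
    rw [e1, e2, e3] at main
  · refine Or.inl ?_
    funext y x
    rw [main]; simp
  · refine Or.inr (Or.inl ?_)
    funext y x
    rw [main]; simp [rot]
  · refine Or.inr (Or.inr (Or.inl ?_))
    funext y x
    rw [main]; simp [rot]
  · refine Or.inr (Or.inr (Or.inr (Or.inl ?_)))
    funext y x
    rw [main, pent_p hac hcd]; simp
  · refine Or.inr (Or.inr (Or.inr (Or.inr ?_)))
    funext y x
    rw [main, pent_wval hac hcd]; simp

end Pent

/-- the pentagon case in the `s`-Tamari lattice.  If `(a,b)` is not a
Tamari tree ascent of `Q`, then `[T, Z ∨ Q] = {T, Z, Q, P, Z ∨ Q}` in the `s`-Tamari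
lattice is a pentagon, with the two maximal chains `T ⋖ Z ⋖ Z ∨ Q` (labels `a, c`) and
`T ⋖ Q ⋖ P ⋖ Z ∨ Q` (labels `c, a, a`), the labels being the smaller elements of the
Tamari tree ascents along which the rotations are performed. -/
theorem tam_pentagon_interval (n : ℕ) (s : ℕ → ℕ) (T Z Q W : SDecTree n s)
    (a b c d : ℕ) (hT : SDecTree.IsTamari T) (hac : a < c)
    (hZ : SDecTree.IsTamRotation T Z a b) (hQ : SDecTree.IsTamRotation T Q c d)
    (hQa : ¬ Q.TamariAscent a b) (hW : SDecTree.IsTamJoin Z Q W) :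
    ∃ P : SDecTree n s,
      SDecTree.IsTamari P ∧
      {U : SDecTree n s | SDecTree.IsTamari U ∧ SDecTree.wle T U ∧ SDecTree.wle U W} =
        {T, Z, Q, P, W} ∧
      (T ≠ Z ∧ T ≠ Q ∧ T ≠ P ∧ T ≠ W ∧ Z ≠ Q ∧ Z ≠ P ∧ Z ≠ W ∧ Q ≠ P ∧ Q ≠ W ∧ P ≠ W) ∧
      SDecTree.tamcov T Z ∧ SDecTree.tamcov Z W ∧
      SDecTree.tamcov T Q ∧ SDecTree.tamcov Q P ∧ SDecTree.tamcov P W ∧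
      SDecTree.IsTamRotation Z W c d ∧ SDecTree.IsTamRotation Q P a d ∧
      SDecTree.IsTamRotation P W a c := by
  have hTI := T.ti hT
  rw [T.tamRot_iff Z hT] at hZ
  rw [T.tamRot_iff Q hT] at hQ
  obtain ⟨hab, hsb, hZc⟩ := hZ
  obtain ⟨hcd, hsd, hQc⟩ := hQ
  obtain ⟨hWT, hZW, hQW, hWmin⟩ := hW
  have hZI : TI n s Z.card := hZc ▸ rot_ti hTI hab hsb
  have hQI : TI n s Q.card := hQc ▸ rot_ti hTI hcd hsd
  have hZT : Z.IsTamari := hZI.tam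
  have hQT : Q.IsTamari := hQI.tam
  have hbc : b = c ∧ T.card c a = 0 := by
    by_contra hn
    refine hQa ((Q.tamAscent_iff hQT a b).2 ?_)
    rw [hQc]
    exact still_ascent hTI hac hab hsb hcd hn
  obtain ⟨rfl, h0⟩ := hbc
  have hdb : b < d := hcd.lt
  -- the tree `P`
  obtain ⟨hp1, hp2⟩ := pent_pq hab hcd hsd h0
  have hPI := rot_ti (hQc ▸ hQI) hp1 hp2
  obtain ⟨P, hPT, hPc⟩ := hPI.exists_tree
  -- the tree `W`
  obtain ⟨hw1, hw2⟩ := pent_w hTI hab hcd hsb h0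
  have hWI := rot_ti hPI hw1 hw2
  obtain ⟨W', hWT', hWc'⟩ := hWI.exists_tree
  have hZval : ∀ y x, Z.card y x = T.card y x + if y = b ∧ Mv T.card a x then 1 else 0 := by
    intro y x; rw [hZc]; rfl
  have hQval : ∀ y x, Q.card y x = T.card y x + if y = d ∧ Mv T.card b x then 1 else 0 := by
    intro y x; rw [hQc]; rfl
  have hPval : ∀ y x, P.card y x = T.card y x + (if y = d ∧ Mv T.card b x then 1 else 0)
      + (if y = d ∧ Mv T.card a x then 1 else 0) := by
    intro y x; rw [hPc]; exact pent_p hab hcd y x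
  have hWval' : ∀ y x, W'.card y x = T.card y x + (if y = d ∧ Mv T.card b x then 1 else 0)
      + (if y = d ∧ Mv T.card a x then 1 else 0) + (if y = b ∧ Mv T.card a x then 1 else 0) := by
    intro y x; rw [hWc']; exact pent_wval hab hcd y x
  have hWW' : W = W' := by
    refine SDecTree.eq_of_card W W' hWT hWT' ?_
    have hle : SDecTree.wle W W' := by
      refine hWmin W' hWT' ?_ ?_
      · intro y x
        have := hZval y x
        have := hWval' y x
        omega
      · intro y x
        have := hQval y x
        have := hWval' y x
        omega
    funext y x
    refine le_antisymm (hle y x) ?_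
    have w1 := hZW y x
    have w2 := hQW y x
    rw [hZval] at w1
    rw [hQval] at w2
    rw [hWval']
    by_cases hA : Mv T.card a x
    · have hC := pent_mv0 hTI hab h0 hA
      have hxb : x < b := by
        rcases hA with h | ⟨h, _⟩ <;> omega
      by_cases hyd : y = d
      · subst hyd
        have v1 := hZW b x
        rw [hZval, if_pos ⟨rfl, hA⟩] at v1
        have v2 := (W.ti hWT).tr x b y hxb hdb (by omega)
        have v3 := hQW y b
        rw [hQval, if_pos ⟨rfl, Or.inl rfl⟩] at v3
        have v4 := hA.eq hTI (z := y) (by omega)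
        have v5 := hab.eq y hdb
        rw [if_neg (by tauto), if_pos ⟨rfl, hA⟩, if_neg (by omega)]
        omega
      · rw [if_neg (by tauto), if_neg (by tauto)]
        omega
    · rw [if_neg (c := y = d ∧ Mv T.card a x) (by tauto),
        if_neg (c := y = b ∧ Mv T.card a x) (by tauto)]
      omega
  subst hWW'
  have hclass : ∀ U : SDecTree n s, U.IsTamari → SDecTree.wle T U → SDecTree.wle U W →
      U = T ∨ U = Z ∨ U = Q ∨ U = P ∨ U = W := by
    intro U hU h1 h2
    have := pent_class hTI hab hcd h0 (U.ti hU) h1 (fun y x => hWc' ▸ h2 y x)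
    rw [← hWc', ← hPc, ← hQc, ← hZc] at this
    rcases this with h | h | h | h | h
    · exact Or.inl (SDecTree.eq_of_card _ _ hU hT h)
    · exact Or.inr (Or.inl (SDecTree.eq_of_card _ _ hU hZT h))
    · exact Or.inr (Or.inr (Or.inl (SDecTree.eq_of_card _ _ hU hQT h)))
    · exact Or.inr (Or.inr (Or.inr (Or.inl (SDecTree.eq_of_card _ _ hU hPT h))))
    · exact Or.inr (Or.inr (Or.inr (Or.inr (SDecTree.eq_of_card _ _ hU hWT h))))
  -- order relations
  have refl : ∀ U : SDecTree n s, SDecTree.wle U U := fun U y x => le_rfl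
  have trans : ∀ U V X : SDecTree n s, SDecTree.wle U V → SDecTree.wle V X → SDecTree.wle U X :=
    fun U V X h1 h2 y x => (h1 y x).trans (h2 y x)
  have hTZ : SDecTree.wle T Z := fun y x => by have := hZval y x; omega
  have hTQ : SDecTree.wle T Q := fun y x => by have := hQval y x; omega
  have hQP : SDecTree.wle Q P := fun y x => by
    have := hQval y x; have := hPval y x; omega
  have hPW : SDecTree.wle P W := fun y x => by
    have := hPval y x; have := hWval' y x; omega
  have hTP := trans _ _ _ hTQ hQP
  have hTW := trans _ _ _ hTZ hZW
  have ma : Mv T.card a a := Or.inl rfl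
  have mb : Mv T.card b b := Or.inl rfl
  have mna : ¬ Mv T.card b a := pent_mv0 hTI hab h0 ma
  have mnb : ¬ Mv T.card a b := fun hh => pent_mv0 hTI hab h0 hh mb
  have n1 : b ≠ d := by omega
  have n2 : d ≠ b := by omega
  have zba := hZval b a
  have qba := hQval b a
  have pba := hPval b a
  have wba := hWval' b a
  have zda := hZval d a
  have qda := hQval d a
  have pda := hPval d a
  have wda := hWval' d a
  have zdb := hZval d b
  have qdb := hQval d b
  have pdb := hPval d b
  have wdb := hWval' d b
  simp [ma, mb, mna, mnb, n1, n2] at zba qba pba wba zda qda pda wda zdb qdb pdb wdb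
  have nZT : ¬ SDecTree.wle Z T := fun hh => by have := hh b a; omega
  have nQT : ¬ SDecTree.wle Q T := fun hh => by have := hh d b; omega
  have nPQ : ¬ SDecTree.wle P Q := fun hh => by have := hh d a; omega
  have nWP : ¬ SDecTree.wle W P := fun hh => by have := hh b a; omega
  have nWZ : ¬ SDecTree.wle W Z := fun hh => by have := hh d b; omega
  have nZP : ¬ SDecTree.wle Z P := fun hh => by have := hh b a; omega
  have nQZ : ¬ SDecTree.wle Q Z := fun hh => by have := hh d b; omega
  have nPZ : ¬ SDecTree.wle P Z := fun hh => by have := hh d b; omega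
  have nZQ : ¬ SDecTree.wle Z Q := fun hh => nZP (trans _ _ _ hh hQP)
  have nPT : ¬ SDecTree.wle P T := fun hh => nPQ (trans _ _ _ hh hTQ)
  have nWT : ¬ SDecTree.wle W T := fun hh => nWZ (trans _ _ _ hh hTZ)
  have nWQ : ¬ SDecTree.wle W Q := fun hh => nWP (trans _ _ _ hh hQP)
  have ne : ∀ U V : SDecTree n s, ¬ SDecTree.wle V U → U ≠ V := by
    rintro U V hh rfl
    exact hh (refl _)
  have cov : ∀ X Y : SDecTree n s, X.IsTamari → Y.IsTamari → SDecTree.wle T X →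
      SDecTree.wle Y W → SDecTree.wle X Y → ¬ SDecTree.wle Y X →
      (∀ U, U = T ∨ U = Z ∨ U = Q ∨ U = P ∨ U = W → SDecTree.wle X U → SDecTree.wle U Y →
        ¬ SDecTree.wle U X → ¬ SDecTree.wle Y U → False) → SDecTree.tamcov X Y := by
    intro X Y hX hY hTX hYW hXY hnYX hall
    refine ⟨hX, hY, ⟨hXY, hnYX⟩, ?_⟩
    intro U hU h1 h2
    exact hall U (hclass U hU (trans _ _ _ hTX h1.1) (trans _ _ _ h2.1 hYW)) h1.1 h2.1 h1.2 h2.2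
  refine ⟨P, hPT, ?_, ⟨ne _ _ nZT, ne _ _ nQT, ne _ _ nPT, ne _ _ nWT, ne _ _ nQZ, ne _ _ nPZ,
    ne _ _ nWZ, ne _ _ nPQ, ne _ _ nWQ, ne _ _ nWP⟩, ?_, ?_, ?_, ?_, ?_, ?_, ?_, ?_⟩
  · ext U
    simp only [Set.mem_ofPred_eq, Set.mem_insert_iff, Set.mem_singleton_iff]
    constructor
    · rintro ⟨h1, h2, h3⟩
      exact hclass U h1 h2 h3
    · rintro (rfl | rfl | rfl | rfl | rfl)
      · exact ⟨hT, refl _, hTW⟩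
      · exact ⟨hZT, hTZ, hZW⟩
      · exact ⟨hQT, hTQ, hQW⟩
      · exact ⟨hPT, hTP, hPW⟩
      · exact ⟨hWT, hTW, refl _⟩
  · refine cov _ _ hT hZT (refl _) hZW hTZ nZT ?_
    rintro U (rfl | rfl | rfl | rfl | rfl) h1 h2 h3 h4
    · exact h3 h1
    · exact h4 h2
    · exact nQZ h2
    · exact nPZ h2
    · exact nWZ h2
  · refine cov _ _ hZT hWT hTZ (refl _) hZW nWZ ?_
    rintro U (rfl | rfl | rfl | rfl | rfl) h1 h2 h3 h4
    · exact nZT h1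
    · exact h3 h1
    · exact nZQ h1
    · exact nZP h1
    · exact h4 h2
  · refine cov _ _ hT hQT (refl _) hQW hTQ nQT ?_
    rintro U (rfl | rfl | rfl | rfl | rfl) h1 h2 h3 h4
    · exact h3 h1
    · exact nZQ h2
    · exact h4 h2
    · exact nPQ h2
    · exact nWQ h2
  · refine cov _ _ hQT hPT hTQ hPW hQP nPQ ?_
    rintro U (rfl | rfl | rfl | rfl | rfl) h1 h2 h3 h4
    · exact nQT h1
    · exact nQZ h1
    · exact h3 h1
    · exact h4 h2
    · exact nWP h2
  · refine cov _ _ hPT hWT hTP (refl _) hPW nWP ?_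
    rintro U (rfl | rfl | rfl | rfl | rfl) h1 h2 h3 h4
    · exact nPT h1
    · exact nPZ h1
    · exact nPQ h1
    · exact h3 h1
    · exact h4 h2
  · rw [Z.tamRot_iff W hZT, hZc, hWc']
    obtain ⟨h1, h2⟩ := pent_zw hab hcd hsd
    exact ⟨h1, h2, (pent_zwval hTI hab hcd h0).symm⟩
  · rw [Q.tamRot_iff P hQT, hQc, hPc]
    exact ⟨hp1, hp2, rfl⟩
  · rw [P.tamRot_iff W hPT, hPc, hWc']
    exact ⟨hw1, hw2, rfl⟩
end
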